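/- arXiv:1906.10950 — 2 statements merged into one kernel-verified Lean document; each statement's English description precedes it below -/
import Mathlib

section
/- Let S = {a_1, a_2, a_3} ⊂ R^2 be three points in weak general position with respect to a polytope K (with 0 in its interior). If all three sectors H_S(a_i) are non-empty, then the bisector bis(a_1, a_2, a_3) consists of exactly one point. -/
def WeakGenPos {d : ℕ} (K : Set (Fin d → ℝ)) (v : Fin d → ℝ) : Prop :=
  ¬ ∃ x y : Fin d → ℝ, x ≠ y ∧ segment ℝ x y ⊆ frontier K ∧ ∃ t : ℝ, y - x = t • v

def Halfsphere {d : ℕ} (K : Set (Fin d → ℝ)) (v : Fin d → ℝ) : Set (Fin d → ℝ) :=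
  {x | x ∈ frontier K ∧
    ∀ l : (Fin d → ℝ) →L[ℝ] ℝ, l ≠ 0 → (∀ y ∈ K, l y ≤ l x) → 0 < l v}

namespace ThreePoint
open Set

/-- a convex function with `g w ≤ g v`, `v < w`, does not increase before `w` starting before `v`. -/
theorem conv_slope {I : Set ℝ} {g : ℝ → ℝ} (hg : ConvexOn ℝ I g) {a b v w : ℝ}
    (ha : a ∈ I) (hw : w ∈ I) (hav : a ≤ v) (hvw : v < w) (hab : a ≤ b) (hbw : b ≤ w)
    (h : g w ≤ g v) : g b ≤ g a := by
  have key : ∀ z, a ≤ z → z ≤ w → (w - a) * g z ≤ (w - z) * g a + (z - a) * g w := by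
    intro z h1 h2
    have hwa : 0 < w - a := by linarith
    have := hg.2 ha hw
      (div_nonneg (by linarith) hwa.le : 0 ≤ (w - z) / (w - a))
      (div_nonneg (by linarith) hwa.le : 0 ≤ (z - a) / (w - a))
      (by field_simp; ring)
    simp only [smul_eq_mul] at this
    have e : (w - z) / (w - a) * a + (z - a) / (w - a) * w = z := by field_simp; ring
    rw [e] at this
    have h3 := mul_le_mul_of_nonneg_left this hwa.le
    have e2 : (w - a) * ((w - z) / (w - a) * g a + (z - a) / (w - a) * g w)
      = (w - z) * g a + (z - a) * g w := by field_simp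
    linarith
  have k1 := key v hav hvw.le
  have k2 := key b hab hbw
  have h1 : g w ≤ g a := by
    by_contra hc
    push Not at hc
    nlinarith [mul_pos (sub_pos.2 hvw) (sub_pos.2 hc), mul_nonneg (sub_nonneg.2 (hav.trans hvw.le)) (sub_nonneg.2 h)]
  by_contra hc
  push Not at hc
  have hwa : 0 < w - a := by linarith
  nlinarith [mul_pos hwa (sub_pos.2 hc), mul_nonneg (sub_nonneg.2 hab) (sub_nonneg.2 h1)]

theorem interior_push {E : Type*} [NormedAddCommGroup E] [NormedSpace ℝ E] {C : Set E} {p : E}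
    (hp : p ∈ interior C) (v : E) : ∃ δ > (0:ℝ), p + δ • v ∈ C := by
  have hc : Continuous (fun t : ℝ => p + t • v) := by fun_prop
  have : ∀ᶠ t in nhds (0:ℝ), p + t • v ∈ C := by
    apply hc.continuousAt.eventually
    simpa using mem_interior_iff_mem_nhds.1 hp
  obtain ⟨δ, hδ, h⟩ := Metric.eventually_nhds_iff.1 this
  exact ⟨δ / 2, by positivity, h (by rw [dist_zero_right, Real.norm_eq_abs, abs_of_pos (by positivity)]; linarith)⟩

/-- support functional at a boundary point -/
theorem exists_support {E : Type*} [NormedAddCommGroup E] [NormedSpace ℝ E] {K : Set E}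
    (hK : Convex ℝ K) (hne : (interior K).Nonempty) {t : Set E} (ht : Convex ℝ t)
    (hd : Disjoint (interior K) t) (htn : t.Nonempty) :
    ∃ l : E →L[ℝ] ℝ, l ≠ 0 ∧ ∀ y ∈ K, ∀ b ∈ t, l y ≤ l b := by
  obtain ⟨f, u, h1, h2⟩ := geometric_hahn_banach_open hK.interior isOpen_interior ht hd
  refine ⟨f, ?_, ?_⟩
  · rintro rfl
    obtain ⟨a, ha⟩ := hne
    obtain ⟨b, hb⟩ := htn
    have := h1 a ha
    have := h2 b hb
    simp at *
    linarith
  · intro y hy b hb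
    have hy' : y ∈ closure (interior K) := by
      rw [hK.closure_interior_eq_closure_of_nonempty_interior hne]
      exact subset_closure hy
    have : y ∈ {z | f z ≤ u} :=
      closure_minimal (fun z hz => (h1 z hz).le) (isClosed_le f.continuous continuous_const) hy'
    exact le_trans this (h2 b hb)

theorem support_at {E : Type*} [NormedAddCommGroup E] [NormedSpace ℝ E] {K : Set E}
    (hK : Convex ℝ K) (hne : (interior K).Nonempty) {p : E} (hp : p ∈ frontier K) :
    ∃ l : E →L[ℝ] ℝ, l ≠ 0 ∧ ∀ y ∈ K, l y ≤ l p := by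
  obtain ⟨l, h, h'⟩ := exists_support hK hne (convex_singleton p)
    (by rw [Set.disjoint_singleton_right]; exact hp.2) (singleton_nonempty p)
  exact ⟨l, h, fun y hy => h' y hy p rfl⟩

/-- maximal points of a nonzero functional are frontier points -/
theorem frontier_of_max {E : Type*} [NormedAddCommGroup E] [NormedSpace ℝ E] {K : Set E}
    {l : E →L[ℝ] ℝ} (hl : l ≠ 0) {p : E} (hp : p ∈ K) (h : ∀ y ∈ K, l y ≤ l p) :
    p ∈ frontier K := by
  refine ⟨subset_closure hp, fun hi => ?_⟩
  obtain ⟨v, hv⟩ : ∃ v, l v ≠ 0 := by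
    by_contra hc; push Not at hc; exact hl (by ext v; simpa using hc v)
  obtain ⟨δ, hδ, hm⟩ := interior_push hi (l v • v)
  have := h _ hm
  simp at this
  have h2 : 0 < δ * (l v * l v) := mul_pos hδ (mul_self_pos.2 hv)
  linarith

theorem combo_int {E : Type*} [NormedAddCommGroup E] [NormedSpace ℝ E] {K : Set E}
    (hK : Convex ℝ K) {p q z : E} (hp : p ∈ K) (hq : q ∈ interior K) {t : ℝ} (h0 : 0 < t)
    (h1 : t ≤ 1) (hz : z = (1 - t) • p + t • q) : z ∈ interior K := by
  rw [hz]
  exact hK.combo_self_interior_mem_interior hp hq (by linarith) h0 (by ring)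

theorem halfsphere_int {E : Type*} [NormedAddCommGroup E] [NormedSpace ℝ E] {K : Set E}
    (hK : Convex ℝ K) (hcl : IsClosed K) (hne : (interior K).Nonempty) {x v : E}
    (hx : x ∈ frontier K)
    (h : ∀ l : E →L[ℝ] ℝ, l ≠ 0 → (∀ y ∈ K, l y ≤ l x) → 0 < l v) :
    ∃ ε > (0:ℝ), ∀ δ, 0 < δ → δ ≤ ε → x - δ • v ∈ interior K := by
  have hxK : x ∈ K := hcl.frontier_subset hx
  by_cases hc : ∃ ε > (0:ℝ), x - ε • v ∈ interior K
  · obtain ⟨ε, he, hi⟩ := hc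
    refine ⟨ε, he, fun δ hd hde => combo_int hK hxK hi (t := δ / ε) (by positivity)
      ((div_le_one he).2 hde) ?_⟩
    have : δ = δ / ε * ε := by field_simp
    rw [smul_sub, smul_smul, ← this]
    module
  · push Not at hc
    exfalso
    obtain ⟨l, hl, hl'⟩ := exists_support hK hne (t := (fun s : ℝ => x - s • v) '' Ici 0)
      (by
        rintro _ ⟨s, hs, rfl⟩ _ ⟨t, ht, rfl⟩ a b ha hb hab
        refine ⟨a * s + b * t, by simp only [mem_Ici] at *; positivity, ?_⟩
        have : b = 1 - a := by linarith
        subst this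
        simp only
        module)
      (by
        rw [Set.disjoint_right]
        rintro _ ⟨s, hs, rfl⟩ hi
        rcases eq_or_lt_of_le (show (0:ℝ) ≤ s from hs) with h0 | h0
        · subst h0; simp at hi; exact hx.2 hi
        · exact hc s h0 hi)
      ⟨x, 0, by simp, by simp⟩
    have h1 := h l hl (fun y hy => hl' y hy x ⟨0, by simp, by simp⟩)
    have h2 := hl' x hxK (x - (1:ℝ) • v) ⟨1, by simp, by simp⟩
    simp at h2
    linarith

theorem sum3 {M : Type*} [AddCommMonoid M] (f : Fin 3 → M) {i j k : Fin 3} (hij : i ≠ j)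
    (hik : i ≠ k) (hjk : j ≠ k) : ∑ x, f x = f i + f j + f k := by
  have : (Finset.univ : Finset (Fin 3)) = {i, j, k} := by
    revert i j k; decide
  rw [this, Finset.sum_insert (by simp [hij, hik]), Finset.sum_insert (by simp [hjk]),
    Finset.sum_singleton, add_assoc]

theorem uniq_aux {K : Set (Fin 2 → ℝ)} (hK : Convex ℝ K) (hcl : IsClosed K)
    (hne : (interior K).Nonempty) {u v w z : Fin 2 → ℝ} (hu : u ∈ K) (hv : v ∈ K)
    (hz : z ∈ frontier K) (hzv : z ≠ v)
    (hw : w ∈ K) {s β γ : ℝ} (hs : 0 < s) (hβ : 0 < β) (hγ : 0 ≤ γ)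
    (hcomb : (s + β + γ) • z = s • u + β • v + γ • w)
    (hW : WeakGenPos K (v - z))
    (hspan : ∀ l : (Fin 2 → ℝ) →L[ℝ] ℝ, l z = l v → l z = l w → l = 0) : False := by
  obtain ⟨l, hl, hl'⟩ := support_at hK hne hz
  have e := congrArg l hcomb
  simp only [map_add, map_smul, smul_eq_mul] at e
  have h1 := hl' u hu
  have h2 := hl' v hv
  have h3 := hl' w hw
  have e1 : s * (l z - l u) + β * (l z - l v) + γ * (l z - l w) = 0 := by linarith
  have n1 := mul_nonneg hs.le (sub_nonneg.2 h1)
  have n2 := mul_nonneg hβ.le (sub_nonneg.2 h2)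
  have n3 := mul_nonneg hγ (sub_nonneg.2 h3)
  have z1 : l z = l u := by
    have : s * (l z - l u) = 0 := by linarith
    rcases mul_eq_zero.1 this with h | h <;> linarith
  have z2 : l z = l v := by
    have : β * (l z - l v) = 0 := by linarith
    rcases mul_eq_zero.1 this with h | h <;> linarith
  rcases hγ.eq_or_lt with h0 | h0
  · subst h0
    have key : v - u = ((s + β) / s) • (v - z) := by
      have h5 : s • (v - u) = (s + β) • (v - z) := by
        rw [add_zero, zero_smul, add_zero] at hcomb
        rw [smul_sub, smul_sub, hcomb]; module
      rw [div_eq_inv_mul, mul_smul, ← h5, smul_smul, inv_mul_cancel₀ hs.ne', one_smul]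
    refine hW ⟨u, v, ?_, ?_, _, key⟩
    · rintro rfl
      rw [sub_self] at key
      rcases smul_eq_zero.1 key.symm with h | h
      · have : 0 < (s + β) / s := by positivity
        linarith
      · exact hzv (sub_eq_zero.1 h).symm
    · intro y hy
      have hyK : y ∈ K := hK.segment_subset hu hv hy
      obtain ⟨a, b, ha, hb, hab, rfl⟩ := hy
      refine frontier_of_max hl hyK (fun y hy => ?_)
      have : l (a • u + b • v) = l z := by
        simp only [map_add, map_smul, smul_eq_mul]
        rw [← z1, ← z2, ← add_mul, hab, one_mul]
      rw [this]; exact hl' y hy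
  · have z3 : l z = l w := by
      have : γ * (l z - l w) = 0 := by linarith
      rcases mul_eq_zero.1 this with h | h <;> linarith
    exact hl (hspan l z2 z3)

structure Cfg (K : Set (Fin 2 → ℝ)) (p : Fin 3 → Fin 2 → ℝ) : Prop where
  fr : ∀ i, p i ∈ frontier K
  inj : ∀ i j, i ≠ j → p i ≠ p j
  span : ∀ l : (Fin 2 → ℝ) →L[ℝ] ℝ, (∀ i j, l (p i) = l (p j)) → l = 0
  wgp : ∀ i j, i ≠ j → WeakGenPos K (p i - p j)

theorem wgp_smul {K : Set (Fin 2 → ℝ)} {v : Fin 2 → ℝ} (h : WeakGenPos K v) (s : ℝ) :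
    WeakGenPos K (s • v) := by
  rintro ⟨x, y, h1, h2, t, h3⟩
  exact h ⟨x, y, h1, h2, t * s, by rw [h3, smul_smul]⟩

theorem uniq2 {K : Set (Fin 2 → ℝ)} (hK : Convex ℝ K) (hcl : IsClosed K)
    (hne : (interior K).Nonempty) {p p' : Fin 3 → Fin 2 → ℝ} (hp : Cfg K p) (hp' : Cfg K p')
    {s : ℝ} (hs : 0 < s) {q : Fin 3 → ℝ} (hq : ∑ i, q i = 1 - s)
    (he : ∀ i, p' i = ∑ j, q j • p j + s • p i) {i j k : Fin 3} (hij : i ≠ j)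
    (hik : i ≠ k) (hjk : j ≠ k) (hj : 0 < q j) (hk : 0 ≤ q k) : False := by
  refine uniq_aux hK hcl hne (u := p i) (v := p' j) (w := p' k) (z := p' i) (s := s)
    (hcl.frontier_subset (hp.fr i)) (hcl.frontier_subset (hp'.fr j)) (hp'.fr i)
    (hp'.inj i j hij) (hcl.frontier_subset (hp'.fr k)) hs hj hk ?_ (hp'.wgp j i hij.symm) ?_
  · rw [sum3 _ hij hik hjk] at hq
    have hi : q i = 1 - s - q j - q k := by linarith
    rw [he i, he j, he k, sum3 _ hij hik hjk, hi]
    module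
  · intro l h1 h2
    apply hp'.span
    have : ∀ m, l (p' m) = l (p' i) := by
      intro m
      have : m = i ∨ m = j ∨ m = k := by
        clear h1 h2 hj hk
        revert i j k m; decide
      rcases this with rfl | rfl | rfl
      · rfl
      · exact h1.symm
      · exact h2.symm
    intro a b
    rw [this a, this b]

theorem uniq3 {K : Set (Fin 2 → ℝ)} (hK : Convex ℝ K) (hcl : IsClosed K)
    (hne : (interior K).Nonempty) {p p' : Fin 3 → Fin 2 → ℝ} (hp : Cfg K p) (hp' : Cfg K p')
    {s : ℝ} (hs : 0 < s) {q : Fin 3 → ℝ} (hq : ∑ i, q i = 1 - s)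
    (he : ∀ i, p' i = ∑ j, q j • p j + s • p i) : q = 0 := by
  have A : ∀ i j k : Fin 3, i ≠ j → i ≠ k → j ≠ k → 0 < q j → 0 ≤ q k → False :=
    fun i j k h1 h2 h3 h4 h5 => uniq2 hK hcl hne hp hp' hs hq he h1 h2 h3 h4 h5
  have B : ∀ i j k : Fin 3, i ≠ j → i ≠ k → j ≠ k → q j < 0 → q k ≤ 0 → False := by
    intro i j k h1 h2 h3 h4 h5
    refine uniq2 hK hcl hne hp' hp (inv_pos.2 hs) (q := fun i => - (s⁻¹ * q i)) ?_ ?_ h1 h2 h3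
      ?_ ?_
    · rw [Finset.sum_neg_distrib, ← Finset.mul_sum, hq]
      field_simp; ring
    · intro m
      have : ∑ j, (-(s⁻¹ * q j)) • p' j = -(s⁻¹ • ∑ j, q j • p j) := by
        have e : ∀ j, (-(s⁻¹ * q j)) • p' j =
            (-(s⁻¹ * q j)) • (∑ j, q j • p j) + (-(q j • p j)) := by
          intro j
          rw [he j, smul_add, smul_smul]
          congr 1
          rw [← neg_smul]; congr 1; field_simp
        simp only [e]
        rw [Finset.sum_add_distrib, ← Finset.sum_smul, Finset.sum_neg_distrib,
          Finset.sum_neg_distrib, ← Finset.mul_sum, hq]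
        generalize (∑ j, q j • p j) = c
        have : -(s⁻¹ * (1 - s)) = 1 - s⁻¹ := by field_simp; ring
        rw [this]; module
      rw [this, he m, smul_add, smul_smul, inv_mul_cancel₀ hs.ne', one_smul]
      module
    · have := mul_pos (inv_pos.2 hs) (neg_pos.2 h4); linarith
    · have := mul_nonneg (inv_pos.2 hs).le (neg_nonneg.2 h5); linarith
  have key : ∀ i j k : Fin 3, i ≠ j → i ≠ k → j ≠ k → q j = 0 := by
    intro i j k h1 h2 h3
    rcases lt_trichotomy (q j) 0 with h | h | h
    · exfalso
      rcases le_or_gt (q k) 0 with h' | h'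
      · exact B i j k h1 h2 h3 h h'
      rcases le_or_gt (q i) 0 with h'' | h''
      · exact B k j i h3.symm h2.symm h1.symm h h''
      · exact A j i k h1.symm h3 h2 h'' h'.le
    · exact h
    · exfalso
      rcases le_or_gt 0 (q k) with h' | h'
      · exact A i j k h1 h2 h3 h h'
      rcases le_or_gt 0 (q i) with h'' | h''
      · exact A k j i h3.symm h2.symm h1.symm h h''
      · exact B j i k h1.symm h3 h2 h'' h'.le
  funext m
  fin_cases m
  · exact key 1 0 2 (by decide) (by decide) (by decide)
  · exact key 0 1 2 (by decide) (by decide) (by decide)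
  · exact key 0 2 1 (by decide) (by decide) (by decide)

/-- Inscribed positive homothet of the standard triangle. -/
theorem exist_aux {C : Set (ℝ × ℝ)} (hC : Convex ℝ C) (hcpt : IsCompact C)
    (hseg : ∀ x y z : ℝ, (x, z) ∈ C → (y, z) ∈ C → x ≠ y →
      ¬ segment ℝ ((x, z) : ℝ × ℝ) (y, z) ⊆ frontier C)
    {u₁ v₁ u₂ v₂ u₃ v₃ ε : ℝ} (hε : 0 < ε)
    (f₁ : (u₁, v₁) ∈ frontier C) (f₂ : (u₂, v₂) ∈ frontier C) (f₃ : (u₃, v₃) ∈ frontier C)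
    (i11 : (u₁ + ε, v₁) ∈ interior C) (i12 : (u₁, v₁ + ε) ∈ interior C)
    (i21 : (u₂ - ε, v₂) ∈ interior C) (i22 : (u₂ - ε, v₂ + ε) ∈ interior C)
    (i31 : (u₃, v₃ - ε) ∈ interior C) (i32 : (u₃ + ε, v₃ - ε) ∈ interior C) :
    ∃ x y s : ℝ, 0 < s ∧ (x, y) ∈ frontier C ∧ (x + s, y) ∈ frontier C ∧
      (x, y + s) ∈ frontier C := by
  have hcl : IsClosed C := hcpt.isClosed
  set Y : Set ℝ := Prod.snd '' C with hY
  have hYc : Convex ℝ Y := hC.linear_image (LinearMap.snd ℝ ℝ ℝ)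
  have slice : ∀ y, IsCompact {x : ℝ | (x, y) ∈ C} := by
    intro y
    have : {x : ℝ | (x, y) ∈ C} = Prod.fst '' (C ∩ {p | p.2 = y}) := by
      ext x; constructor
      · intro h; exact ⟨(x, y), ⟨h, rfl⟩, rfl⟩
      · rintro ⟨⟨a, b⟩, ⟨h, h2⟩, rfl⟩; have h2' : b = y := h2
        subst h2'; exact h
    rw [this]
    exact (hcpt.inter_right (isClosed_eq continuous_snd continuous_const)).image continuous_fst
  have sliceN : ∀ y ∈ Y, {x : ℝ | (x, y) ∈ C}.Nonempty := by
    rintro _ ⟨⟨a, b⟩, h, rfl⟩; exact ⟨a, h⟩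
  have hf : ∀ y, ∃ a, y ∈ Y → (a, y) ∈ C ∧ ∀ x, (x, y) ∈ C → a ≤ x := by
    intro y
    by_cases hy : y ∈ Y
    · obtain ⟨a, ha, h⟩ := (slice y).exists_isLeast (sliceN y hy)
      exact ⟨a, fun _ => ⟨ha, fun x hx => h hx⟩⟩
    · exact ⟨0, fun h => absurd h hy⟩
  have hh : ∀ y, ∃ a, y ∈ Y → (a, y) ∈ C ∧ ∀ x, (x, y) ∈ C → x ≤ a := by
    intro y
    by_cases hy : y ∈ Y
    · obtain ⟨a, ha, h⟩ := (slice y).exists_isGreatest (sliceN y hy)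
      exact ⟨a, fun _ => ⟨ha, fun x hx => h hx⟩⟩
    · exact ⟨0, fun h => absurd h hy⟩
  choose f hf using hf
  choose h hh using hh
  have memY : ∀ {x y : ℝ}, (x, y) ∈ C → y ∈ Y := fun {x y} hxy => ⟨(x, y), hxy, rfl⟩
  have fle : ∀ {x y : ℝ}, (x, y) ∈ C → f y ≤ x := fun {x y} hxy => (hf y (memY hxy)).2 x hxy
  have leh : ∀ {x y : ℝ}, (x, y) ∈ C → x ≤ h y := fun {x y} hxy => (hh y (memY hxy)).2 x hxy
  have fC : ∀ {y}, y ∈ Y → (f y, y) ∈ C := fun {y} hy => (hf y hy).1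
  have hhC : ∀ {y}, y ∈ Y → (h y, y) ∈ C := fun {y} hy => (hh y hy).1
  have fh : ∀ {y}, y ∈ Y → f y ≤ h y := fun {y} hy => fle (hhC hy)
  have inC : ∀ {x y : ℝ}, y ∈ Y → f y ≤ x → x ≤ h y → (x, y) ∈ C := by
    intro x y hy h1 h2
    rcases h1.eq_or_lt with e | e
    · rw [← e]; exact fC hy
    have hw : 0 < h y - f y := by linarith
    have := hC (fC hy) (hhC hy) (div_nonneg (by linarith) hw.le : 0 ≤ (h y - x) / (h y - f y))
      (div_nonneg (by linarith) hw.le : 0 ≤ (x - f y) / (h y - f y)) (by field_simp; ring)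
    convert this using 1
    ext <;> simp <;> field_simp <;> ring
  have fconv : ConvexOn ℝ Y f := by
    refine ⟨hYc, fun y hy z hz a b ha hb hab => ?_⟩
    exact fle (hC (fC hy) (fC hz) ha hb hab)
  have hconc : ConcaveOn ℝ Y h := by
    refine ⟨hYc, fun y hy z hz a b ha hb hab => ?_⟩
    exact leh (hC (hhC hy) (hhC hz) ha hb hab)
  have intC : ∀ {p}, p ∈ interior C → p ∈ C := fun {p} hp => interior_subset hp
  have intf : ∀ {x y : ℝ}, (x, y) ∈ interior C → f y < x := by
    intro x y hi
    obtain ⟨δ, hδ, hm⟩ := interior_push hi ((-1, 0) : ℝ × ℝ)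
    simp at hm
    have := fle hm
    linarith
  have inth : ∀ {x y : ℝ}, (x, y) ∈ interior C → x < h y := by
    intro x y hi
    obtain ⟨δ, hδ, hm⟩ := interior_push hi ((1, 0) : ℝ × ℝ)
    simp at hm
    have := leh hm
    linarith
  have fF : ∀ {y}, y ∈ Y → (f y, y) ∈ frontier C := fun {y} hy =>
    ⟨subset_closure (fC hy), fun hi => lt_irrefl _ (intf hi)⟩
  have hF : ∀ {y}, y ∈ Y → (h y, y) ∈ frontier C := fun {y} hy =>
    ⟨subset_closure (hhC hy), fun hi => lt_irrefl _ (inth hi)⟩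
  -- interior points on chords
  have chordInt : ∀ {x y z : ℝ}, (x, y) ∈ interior C → f y < z → z < h y →
      (z, y) ∈ interior C := by
    intro x y z hi h1 h2
    have hy := memY (intC hi)
    rcases le_total z x with hzx | hzx
    · have hd : 0 < x - f y := by linarith
      refine combo_int hC (fC hy) hi (t := (z - f y) / (x - f y)) (div_pos (by linarith) hd)
        ((div_le_one hd).2 (by linarith)) ?_
      ext <;> simp <;> field_simp <;> ring
    · have hd : 0 < h y - x := by linarith [inth hi]
      refine combo_int hC (hhC hy) hi (t := (h y - z) / (h y - x)) (div_pos (by linarith) hd)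
        ((div_le_one hd).2 (by linarith)) ?_
      ext <;> simp <;> field_simp <;> ring
  have frC : ∀ {p}, p ∈ frontier C → p ∈ C := fun {p} hp => hcl.frontier_subset hp
  -- extremes
  have e1 : f v₁ = u₁ := by
    refine le_antisymm (fle (frC f₁)) ?_
    by_contra hc
    push Not at hc
    exact f₁.2 (chordInt i11 hc (by linarith [leh (intC i11)]))
  have e2 : h v₂ = u₂ := by
    refine le_antisymm ?_ (leh (frC f₂))
    by_contra hc
    push Not at hc
    exact f₂.2 (chordInt i21 (by linarith [fle (intC i21)]) hc)
  -- bottom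
  obtain ⟨⟨x₀, y₀⟩, hb, hmin⟩ := hcpt.exists_isMinOn ⟨_, frC f₁⟩ continuous_snd.continuousOn
  have hmin' : ∀ {x y : ℝ}, (x, y) ∈ C → y₀ ≤ y := fun {x y} hxy => hmin hxy
  have intmin : ∀ {x y : ℝ}, (x, y) ∈ interior C → y₀ < y := by
    intro x y hi
    obtain ⟨δ, hδ, hm⟩ := interior_push hi ((0, -1) : ℝ × ℝ)
    simp at hm
    have := hmin' hm
    linarith
  have hy0 : y₀ ∈ Y := memY hb
  have w0 : h y₀ = f y₀ := by
    by_contra hc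
    refine hseg _ _ _ (fC hy0) (hhC hy0) (fun e => hc e.symm) (fun p hp => ?_)
    refine ⟨subset_closure (hC.segment_subset (fC hy0) (hhC hy0) hp), fun hi => ?_⟩
    obtain ⟨a, b, ha, hb', hab, rfl⟩ := hp
    have := intmin (x := a * f y₀ + b * h y₀) (y := a * y₀ + b * y₀) (by simpa using hi)
    rw [← add_mul, hab, one_mul] at this
    exact lt_irrefl _ this
  -- the top test height
  set yb := v₃ - ε with hyb
  have hyb0 : y₀ < yb := intmin i31
  have hybY : yb ∈ Y := memY (intC i31)
  have hv1 : y₀ < v₁ := intmin i11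
  have hv2 : y₀ < v₂ := intmin i21
  -- small chords near the bottom
  have small : ∃ y' > y₀, ∀ y ∈ Y, y < y' → h y - f y < ε := by
    set A : Set (ℝ × ℝ) := Prod.snd '' ((C ×ˢ C) ∩ {z : (ℝ × ℝ) × (ℝ × ℝ) |
      z.1.2 = z.2.2 ∧ ε ≤ z.2.1 - z.1.1}) with hA
    have hAc : IsCompact A := by
      refine ((hcpt.prod hcpt).inter_right ?_).image continuous_snd
      have c1 : IsClosed {z : (ℝ × ℝ) × (ℝ × ℝ) | z.1.2 = z.2.2} :=
        isClosed_eq (by fun_prop) (by fun_prop)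
      have c2 : IsClosed {z : (ℝ × ℝ) × (ℝ × ℝ) | ε ≤ z.2.1 - z.1.1} :=
        isClosed_le (by fun_prop) (by fun_prop)
      exact c1.inter c2
    have memA : ∀ y ∈ Y, ε ≤ h y - f y → (h y, y) ∈ A := by
      intro y hy hle
      exact ⟨((f y, y), (h y, y)), ⟨⟨fC hy, hhC hy⟩, rfl, hle⟩, rfl⟩
    by_cases hAn : A.Nonempty
    · obtain ⟨⟨x, y⟩, hm, hm'⟩ := hAc.exists_isMinOn hAn continuous_snd.continuousOn
      have hyy : y₀ < y := by
        obtain ⟨⟨⟨a, b⟩, c, d⟩, ⟨⟨hab, hcd⟩, h1, h2⟩, h3⟩ := hm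
        simp only [Prod.mk.injEq] at h1 h2 h3 hab hcd
        obtain ⟨rfl, rfl⟩ := h3
        subst h1
        refine lt_of_le_of_ne (hmin' hab) ?_
        rintro rfl
        have := fle hab
        have := leh hcd
        linarith
      refine ⟨y, hyy, fun z hz hzy => ?_⟩
      by_contra hc
      push Not at hc
      have : y ≤ z := hm' (memA z hz hc)
      linarith
    · refine ⟨y₀ + 1, by linarith, fun z hz _ => ?_⟩
      by_contra hc
      push Not at hc
      exact hAn ⟨_, memA z hz hc⟩
  obtain ⟨y', hy', hsmall⟩ := small
  -- choose the lower height
  obtain ⟨ya, hya0, hya⟩ : ∃ ya, y₀ < ya ∧ ya < min (min y' yb) (min v₁ v₂) :=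
    exists_between (by simp only [lt_min_iff]; exact ⟨⟨hy', hyb0⟩, hv1, hv2⟩)
  simp only [lt_min_iff] at hya
  obtain ⟨⟨hya1, hya2⟩, hya3, hya4⟩ := hya
  have between : ∀ {a b c : ℝ}, a ∈ Y → c ∈ Y → a ≤ b → b ≤ c → b ∈ Y :=
    fun {a b c} ha hc h1 h2 => hYc.ordConnected.out ha hc ⟨h1, h2⟩
  have hyaY : ya ∈ Y := between hy0 hybY hya0.le hya2.le
  have hsm := hsmall ya hyaY hya1
  have v1Y : v₁ + ε ∈ Y := memY (intC i12)
  have v2Y : v₂ + ε ∈ Y := memY (intC i22)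
  set P : ℝ → ℝ × ℝ := fun y => (f y, y + (h y - f y)) with hP
  have hPa : P ya ∈ C := by
    have hw := fh hyaY
    have hbY : ya + (h ya - f ya) ∈ Y := between hyaY v1Y (by linarith) (by linarith)
    refine inC hbY ?_ ?_
    · refine conv_slope fconv hyaY v1Y hya3.le (by linarith) (by linarith) (by linarith) ?_
      rw [e1]; exact fle (intC i12)
    · have hc : ConvexOn ℝ Y (fun y => - h y - y) :=
        hconc.neg.sub (concaveOn_id hYc)
      have := conv_slope hc (b := ya + (h ya - f ya)) hyaY v2Y hya4.le (by linarith) (by linarith)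
        (by linarith) (by simp only [e2]; linarith [leh (intC i22)])
      linarith
  have hPb : P yb ∉ C := by
    intro hm
    have h1 : f yb < u₃ := intf i31
    have h2 : u₃ + ε < h yb := inth i32
    set w := h yb - f yb with hw
    have hwe : 0 < w - ε := by linarith
    have hwp : 0 < w := by linarith
    set z := (w * u₃ - ε * f yb) / (w - ε) with hz
    have hz1 : f yb < z := by rw [hz, lt_div_iff₀ hwe]; nlinarith
    have hz2 : z < h yb := by rw [hz, div_lt_iff₀ hwe]; nlinarith
    have hzi := chordInt i31 hz1 hz2
    refine f₃.2 (combo_int hC hm hzi (t := (w - ε) / w) (div_pos hwe hwp)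
      ((div_le_one hwp).2 (by linarith)) ?_)
    have hwne : w ≠ 0 := hwp.ne'
    have hwene : w - ε ≠ 0 := hwe.ne'
    ext
    · simp only [hP, Prod.fst_add, Prod.smul_fst, smul_eq_mul, hz]
      field_simp
      ring
    · simp only [hP, Prod.snd_add, Prod.smul_snd, smul_eq_mul, ← hw]
      field_simp
      rw [hyb]; ring
  -- continuity
  obtain ⟨δ, hδ, htop⟩ := interior_push i31 ((0, 1) : ℝ × ℝ)
  simp at htop
  have hsub : Icc ya yb ⊆ interior Y := by
    intro y hy
    have : Ioo y₀ (yb + δ) ⊆ Y := fun z hz => between hy0 (memY htop) hz.1.le hz.2.le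
    exact interior_maximal this isOpen_Ioo ⟨by linarith [hy.1], by linarith [hy.2]⟩
  have fcont : ContinuousOn f (Icc ya yb) := fconv.continuousOn_interior.mono hsub
  have hcont : ContinuousOn h (Icc ya yb) := hconc.continuousOn_interior.mono hsub
  have Pcont : ContinuousOn P (Icc ya yb) :=
    fcont.prodMk (continuousOn_id.add (hcont.sub fcont))
  have hpre : IsPreconnected (P '' Icc ya yb) := isPreconnected_Icc.image P Pcont
  have hPt : ∃ y ∈ Icc ya yb, P y ∈ frontier C := by
    by_contra hc
    push Not at hc
    have hint : ∀ y ∈ Icc ya yb, P y ∈ C → P y ∈ interior C := by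
      intro y hy hm
      by_contra hn
      exact hc y hy ⟨subset_closure hm, hn⟩
    obtain ⟨z, -, hz1, hz2⟩ := hpre (interior C) Cᶜ isOpen_interior hcl.isOpen_compl
      (by
        rintro _ ⟨y, hy, rfl⟩
        by_cases hm : P y ∈ C
        · exact Or.inl (hint y hy hm)
        · exact Or.inr hm)
      ⟨_, ⟨ya, ⟨le_rfl, hya2.le⟩, rfl⟩, hint ya ⟨le_rfl, hya2.le⟩ hPa⟩
      ⟨_, ⟨yb, ⟨hya2.le, le_rfl⟩, rfl⟩, hPb⟩
    exact hz2 (interior_subset hz1)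
  obtain ⟨y, hy, hyf⟩ := hPt
  have hyY : y ∈ Y := interior_subset (hsub hy)
  refine ⟨f y, y, h y - f y, ?_, fF hyY, ?_, hyf⟩
  · have hc : ConcaveOn ℝ Y (fun y => h y - f y) := hconc.sub fconv
    have hD : 0 < yb - y₀ := by linarith
    have := hc.2 hy0 hybY (div_nonneg (by linarith [hy.2]) hD.le : 0 ≤ (yb - y) / (yb - y₀))
      (div_nonneg (by linarith [hy.1]) hD.le : 0 ≤ (y - y₀) / (yb - y₀)) (by field_simp; ring)
    simp only [smul_eq_mul] at this
    have e : (yb - y) / (yb - y₀) * y₀ + (y - y₀) / (yb - y₀) * yb = y := by field_simp; ring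
    rw [e, w0, sub_self, mul_zero, zero_add] at this
    refine lt_of_lt_of_le (mul_pos (div_pos (by linarith [hy.1]) hD) ?_) this
    linarith [intf i31, inth i31]
  · simpa using hF hyY

theorem indep_aux {e d : Fin 2 → ℝ} {l₁ l₂ l₃ : (Fin 2 → ℝ) →L[ℝ] ℝ}
    (h1 : l₁ e < 0) (h1' : l₁ d < 0) (h2 : 0 < l₂ e) (h2' : 0 < l₂ (e - d))
    (h3 : 0 < l₃ d) (h3' : 0 < l₃ (d - e)) {α β : ℝ} (h : α • e + β • d = 0) :
    α = 0 ∧ β = 0 := by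
  have k1 := congrArg l₁ h
  have k2 := congrArg l₂ h
  have k3 := congrArg l₃ h
  simp only [map_add, map_smul, smul_eq_mul, map_zero, map_sub] at *
  have hα : α = 0 := by
    rcases lt_trichotomy α 0 with ha | ha | ha
    · have hb : 0 < β := by
        by_contra hb; push Not at hb
        nlinarith [mul_pos (neg_pos.2 ha) (neg_pos.2 h1), mul_nonneg (neg_nonneg.2 hb) (neg_nonneg.2 h1'.le)]
      rcases le_total (α + β) 0 with hs | hs
      · nlinarith [mul_pos hb h2', mul_nonneg (neg_nonneg.2 hs) h2.le]
      · nlinarith [mul_pos (neg_pos.2 ha) h3', mul_nonneg hs h3.le]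
    · exact ha
    · have hb : β < 0 := by
        by_contra hb; push Not at hb
        nlinarith [mul_pos ha (neg_pos.2 h1), mul_nonneg hb (neg_nonneg.2 h1'.le)]
      rcases le_total (α + β) 0 with hs | hs
      · nlinarith [mul_pos ha h3', mul_nonneg (neg_nonneg.2 hs) h3.le]
      · nlinarith [mul_pos (neg_pos.2 hb) h2', mul_nonneg hs h2.le]
  refine ⟨hα, ?_⟩
  subst hα
  simp at k1
  rcases k1 with k | k
  · exact k
  · linarith

theorem main_aux (K : Set (Fin 2 → ℝ)) (hK : Convex ℝ K) (hcpt : IsCompact K)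
    (h0 : 0 ∈ interior K) (a : Fin 3 → Fin 2 → ℝ) (hinj : ∀ i j, i ≠ j → a i ≠ a j)
    (hwgp : ∀ i j, i ≠ j → WeakGenPos K (a j - a i)) (x : Fin 3 → Fin 2 → ℝ)
    (hx : ∀ i j, i ≠ j → x i ∈ Halfsphere K (a j - a i)) :
    ∃ c, ∀ z, (∀ i, gauge K (z - a i) = gauge K (z - a 0)) ↔ z = c := by
  have hcl := hcpt.isClosed
  have hne : (interior K).Nonempty := ⟨0, h0⟩
  have hnhds : K ∈ nhds (0 : Fin 2 → ℝ) := mem_interior_iff_mem_nhds.1 h0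
  have hfr : ∀ i, x i ∈ frontier K := by
    intro i
    obtain ⟨j, hj⟩ : ∃ j, i ≠ j := by revert i; decide
    exact (hx i j hj).1
  set e := a 0 - a 1 with he
  set d := a 0 - a 2 with hd
  have n01 : (0 : Fin 3) ≠ 1 := by decide
  have n02 : (0 : Fin 3) ≠ 2 := by decide
  have n12 : (1 : Fin 3) ≠ 2 := by decide
  have hind : ∀ α β : ℝ, α • e + β • d = 0 → α = 0 ∧ β = 0 := by
    intro α β h
    have hl : ∀ i, ∃ l : (Fin 2 → ℝ) →L[ℝ] ℝ, ∀ j, i ≠ j → 0 < l (a j - a i) := by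
      intro i
      obtain ⟨l, h1, h2⟩ := support_at hK hne (hfr i)
      exact ⟨l, fun j hj => (hx i j hj).2 l h1 h2⟩
    choose l hl using hl
    refine indep_aux (l₁ := l 0) (l₂ := l 1) (l₃ := l 2) ?_ ?_ ?_ ?_ ?_ ?_ h
    · have := hl 0 1 n01
      simp only [he, map_sub] at *; linarith
    · have := hl 0 2 n02
      simp only [hd, map_sub] at *; linarith
    · exact hl 1 0 n01.symm
    · have := hl 1 2 n12
      simp only [he, hd, map_sub] at *; linarith
    · exact hl 2 0 n02.symm
    · have := hl 2 1 n12.symm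
      simp only [he, hd, map_sub] at *; linarith
  let φ₀ : (ℝ × ℝ) →ₗ[ℝ] (Fin 2 → ℝ) :=
    (LinearMap.fst ℝ ℝ ℝ).smulRight e + (LinearMap.snd ℝ ℝ ℝ).smulRight d
  have hφ₀ : ∀ p, φ₀ p = p.1 • e + p.2 • d := fun p => rfl
  have hφinj : Function.Injective φ₀ := by
    rw [← LinearMap.ker_eq_bot, LinearMap.ker_eq_bot']
    intro m hm
    obtain ⟨h1, h2⟩ := hind _ _ (hm)
    exact Prod.ext h1 h2
  let φ : (ℝ × ℝ) ≃L[ℝ] (Fin 2 → ℝ) :=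
    (LinearMap.linearEquivOfInjective φ₀ hφinj (by simp)).toContinuousLinearEquiv
  have hφ : ∀ p, φ p = p.1 • e + p.2 • d := fun p => rfl
  set C : Set (ℝ × ℝ) := φ ⁻¹' K with hCdef
  have Cint : ∀ p, p ∈ interior C ↔ φ p ∈ interior K := by
    intro p
    have := φ.toHomeomorph.preimage_interior K
    exact (Set.ext_iff.1 this p).symm
  have Cfr : ∀ p, p ∈ frontier C ↔ φ p ∈ frontier K := by
    intro p
    have := φ.toHomeomorph.preimage_frontier K
    exact (Set.ext_iff.1 this p).symm
  have hCconv : Convex ℝ C := hK.linear_preimage φ.toLinearMap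
  have hCc : IsCompact C := φ.toHomeomorph.isCompact_preimage.2 hcpt
  have hg : ∀ i, ∃ ε > (0:ℝ), ∀ j, i ≠ j → ∀ δ, 0 < δ → δ ≤ ε → x i - δ • (a j - a i) ∈ interior K := by
    intro i
    have : ∀ j, ∃ ε > (0:ℝ), i ≠ j → ∀ δ, 0 < δ → δ ≤ ε → x i - δ • (a j - a i) ∈ interior K := by
      intro j
      by_cases hij : i = j
      · exact ⟨1, one_pos, fun h => absurd hij h⟩
      · obtain ⟨ε, h1, h2⟩ := halfsphere_int hK hcl hne (hfr i) (hx i j hij).2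
        exact ⟨ε, h1, fun _ => h2⟩
    choose ε h1 h2 using this
    refine ⟨min (ε 0) (min (ε 1) (ε 2)), lt_min (h1 0) (lt_min (h1 1) (h1 2)), ?_⟩
    intro j hj δ hδ hle
    refine h2 j hj δ hδ (hle.trans ?_)
    fin_cases j <;> simp
  choose E hE hE' using hg
  obtain ⟨ε, hε, hε'⟩ : ∃ ε > (0:ℝ), ∀ i, ε ≤ E i :=
    ⟨min (E 0) (min (E 1) (E 2)), lt_min (hE 0) (lt_min (hE 1) (hE 2)), by
      intro i; fin_cases i <;> simp⟩
  have hI : ∀ i j, i ≠ j → x i - ε • (a j - a i) ∈ interior K :=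
    fun i j hij => hE' i j hij ε hε (hε' i)
  have hsurj : ∀ v : Fin 2 → ℝ, ∃ α β : ℝ, v = α • e + β • d := by
    intro v
    refine ⟨(φ.symm v).1, (φ.symm v).2, ?_⟩
    rw [← hφ, φ.apply_symm_apply]
  obtain ⟨u₁, v₁, q1⟩ := hsurj (x 0)
  obtain ⟨u₂, v₂, q2⟩ := hsurj (x 1)
  obtain ⟨u₃, v₃, q3⟩ := hsurj (x 2)
  obtain ⟨X, Y, s, hs, r1, r2, r3⟩ := exist_aux (C := C) hCconv hCc
    (by
      intro p q z hp hq hpq hsub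
      refine hwgp 1 0 n01.symm ⟨φ (p, z), φ (q, z), ?_, ?_, q - p, ?_⟩
      · intro h
        have := φ.injective h
        simp only [Prod.mk.injEq] at this
        exact hpq this.1
      · intro w hw
        have hw' : φ.symm w ∈ segment ℝ ((p, z) : ℝ × ℝ) (q, z) := by
          obtain ⟨a', b', h1, h2, h3, rfl⟩ := hw
          exact ⟨a', b', h1, h2, h3, by simp⟩
        have := (Cfr _).1 (hsub hw')
        rwa [φ.apply_symm_apply] at this
      · rw [hφ, hφ, ← he]; simp only; module)
    hε (u₁ := u₁) (v₁ := v₁) (u₂ := u₂) (v₂ := v₂) (u₃ := u₃) (v₃ := v₃)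
    ((Cfr _).2 (by rw [hφ, ← q1]; exact hfr 0))
    ((Cfr _).2 (by rw [hφ, ← q2]; exact hfr 1))
    ((Cfr _).2 (by rw [hφ, ← q3]; exact hfr 2))
    ((Cint _).2 (by rw [hφ]; convert hI 0 1 n01 using 1; rw [q1, he]; module))
    ((Cint _).2 (by rw [hφ]; convert hI 0 2 n02 using 1; rw [q1, hd]; module))
    ((Cint _).2 (by rw [hφ]; convert hI 1 0 n01.symm using 1; rw [q2, he]; module))
    ((Cint _).2 (by rw [hφ]; convert hI 1 2 n12 using 1; rw [q2, he, hd]; module))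
    ((Cint _).2 (by rw [hφ]; convert hI 2 0 n02.symm using 1; rw [q3, hd]; module))
    ((Cint _).2 (by rw [hφ]; convert hI 2 1 n12.symm using 1; rw [q3, he, hd]; module))
  rw [Cfr, hφ] at r1 r2 r3
  simp only at r1 r2 r3
  set c := a 0 + s⁻¹ • (X • e + Y • d) with hc
  have hsi : 0 < s⁻¹ := inv_pos.2 hs
  have gfr : ∀ {w : Fin 2 → ℝ}, w ∈ frontier K → gauge K (s⁻¹ • w) = s⁻¹ := by
    intro w hw
    rw [gauge_smul_of_nonneg hsi.le, (gauge_eq_one_iff_mem_frontier hK hnhds).2 hw]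
    simp
  have ex : ∀ i, gauge K (c - a i) = s⁻¹ := by
    have c0 : c - a 0 = s⁻¹ • (X • e + Y • d) := by rw [hc]; abel
    have c1 : c - a 1 = s⁻¹ • ((X + s) • e + Y • d) := by
      have : s⁻¹ • ((X + s) • e + Y • d) = s⁻¹ • (X • e + Y • d) + (s⁻¹ * s) • e := by module
      rw [this, inv_mul_cancel₀ hs.ne', hc, he]; module
    have c2 : c - a 2 = s⁻¹ • (X • e + (Y + s) • d) := by
      have : s⁻¹ • (X • e + (Y + s) • d) = s⁻¹ • (X • e + Y • d) + (s⁻¹ * s) • d := by module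
      rw [this, inv_mul_cancel₀ hs.ne', hc, hd]; module
    intro i
    fin_cases i
    · show gauge K (c - a 0) = _
      rw [c0, gfr r1]
    · show gauge K (c - a 1) = _
      rw [c1, gfr r2]
    · show gauge K (c - a 2) = _
      rw [c2, gfr r3]
  -- configurations from equidistant points
  have hspan : ∀ l : (Fin 2 → ℝ) →L[ℝ] ℝ, (∀ i j, l (a i) = l (a j)) → l = 0 := by
    intro l h
    ext1 v
    obtain ⟨α, β, rfl⟩ := hsurj v
    simp only [map_add, map_smul, he, hd, map_sub, h 1 0, h 2 0]
    simp
  have cfg : ∀ (z : Fin 2 → ℝ) (t : ℝ), 0 < t → (∀ i, gauge K (z - a i) = t) →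
      Cfg K (fun i => t⁻¹ • (z - a i)) := by
    intro z t ht h
    have hti : 0 < t⁻¹ := inv_pos.2 ht
    have hdiff : ∀ i j, t⁻¹ • (z - a i) - t⁻¹ • (z - a j) = t⁻¹ • (a j - a i) := by
      intro i j; module
    refine ⟨fun i => ?_, fun i j hij heq => ?_, fun l hl => ?_, fun i j hij => ?_⟩
    · rw [← gauge_eq_one_iff_mem_frontier hK hnhds, gauge_smul_of_nonneg hti.le, h i, smul_eq_mul,
        inv_mul_cancel₀ ht.ne']
    · have := hdiff i j
      rw [sub_eq_zero.2 heq] at this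
      rcases smul_eq_zero.1 this.symm with h' | h'
      · exact hti.ne' h'
      · exact hinj i j hij (sub_eq_zero.1 h').symm
    · apply hspan
      intro i j
      have := hl i j
      simp only [map_smul, map_sub, smul_eq_mul] at this
      have := mul_left_cancel₀ hti.ne' this
      linarith
    · show WeakGenPos K (t⁻¹ • (z - a i) - t⁻¹ • (z - a j))
      rw [hdiff]
      exact wgp_smul (hwgp i j hij) _
  refine ⟨c, fun z => ⟨fun hz => ?_, fun hz i => by rw [hz, ex, ex]⟩⟩
  set t := gauge K (z - a 0) with ht
  have htpos : 0 < t := by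
    rcases (gauge_nonneg (s := K) (z - a 0)).eq_or_lt with h | h
    · exfalso
      have hpos : ∀ w : Fin 2 → ℝ, gauge K w = 0 → w = 0 := by
        intro w hw
        by_contra hn
        have := (gauge_pos (absorbent_nhds_zero hnhds)
          (NormedSpace.isVonNBounded_of_isBounded ℝ hcpt.isBounded)).2 hn
        linarith
      have z0 := hpos _ h.symm
      have z1 := hpos (z - a 1) (by rw [hz 1, ht, ← h])
      exact hinj 0 1 n01 ((sub_eq_zero.1 z0).symm.trans (sub_eq_zero.1 z1))
    · exact h
  have A := cfg c s⁻¹ hsi ex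
  have B := cfg z t htpos hz
  -- ratio
  set m := t⁻¹ * s⁻¹ with hm
  have hmpos : 0 < m := mul_pos (inv_pos.2 htpos) hsi
  set p : Fin 3 → Fin 2 → ℝ := fun i => (s⁻¹)⁻¹ • (c - a i) with hp
  have hpi : ∀ i, p i = s • (c - a i) := by intro i; simp [hp]
  have rel : ∀ i, t⁻¹ • (z - a i) = t⁻¹ • (z - c) + m • p i := by
    intro i
    have : m * s = t⁻¹ := by rw [hm, mul_assoc, inv_mul_cancel₀ hs.ne', mul_one]
    rw [hpi, smul_smul, this]; module
  -- barycentric coordinates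
  obtain ⟨α, β, hαβ⟩ := hsurj (t⁻¹ • (z - c) - (1 - m) • p 0)
  have hq := uniq3 hK hcl hne A B hmpos
    (q := ![1 - m - s⁻¹ * α - s⁻¹ * β, s⁻¹ * α, s⁻¹ * β])
    (by simp [Fin.sum_univ_three]; ring)
    (by
      intro i
      show t⁻¹ • (z - a i) = ∑ j, _ • p j + m • p i
      rw [rel i]
      congr 1
      have k1 : p 1 = p 0 + s • e := by rw [hpi, hpi, he]; module
      have k2 : p 2 = p 0 + s • d := by rw [hpi, hpi, hd]; module
      rw [sub_eq_iff_eq_add] at hαβ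
      rw [hαβ, Fin.sum_univ_three]
      simp only [Matrix.cons_val_zero, Matrix.cons_val_one, Matrix.cons_val]
      rw [k1, k2]
      have a1 : α • e = (s⁻¹ * α * s) • e := by congr 1; field_simp
      have a2 : β • d = (s⁻¹ * β * s) • d := by congr 1; field_simp
      rw [a1, a2]
      module)
  have q0 := congrFun hq 0
  have q1' := congrFun hq 1
  have q2' := congrFun hq 2
  simp at q0 q1' q2'
  have hα : α = 0 := by rcases q1' with h | h; exacts [absurd h hs.ne', h]
  have hβ : β = 0 := by rcases q2' with h | h; exacts [absurd h hs.ne', h]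
  subst hα hβ
  have hm1 : 1 - m = 0 := by linarith
  rw [hm1, zero_smul, zero_smul, zero_smul, sub_zero, add_zero] at hαβ
  rcases smul_eq_zero.1 hαβ with h | h
  · exact absurd h (inv_pos.2 htpos).ne'
  · exact sub_eq_zero.1 h

end ThreePoint


/-- Three points of the plane in weak general position with respect to a
polytope `K` (with `0` in its interior) whose three sectors are all nonempty
have a bisector consisting of exactly one point. -/
theorem three_point_bisector_singleton (K : Set (Fin 2 → ℝ))
    (hK : ∃ s : Finset (Fin 2 → ℝ), K = convexHull ℝ (s : Set (Fin 2 → ℝ)))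
    (h0 : 0 ∈ interior K) (a₁ a₂ a₃ : Fin 2 → ℝ)
    (h12 : a₁ ≠ a₂) (h13 : a₁ ≠ a₃) (h23 : a₂ ≠ a₃)
    (hwgp : ∀ p ∈ ({a₁, a₂, a₃} : Set (Fin 2 → ℝ)),
      ∀ q ∈ ({a₁, a₂, a₃} : Set (Fin 2 → ℝ)), p ≠ q → WeakGenPos K (q - p))
    (hsec : ∀ p ∈ ({a₁, a₂, a₃} : Set (Fin 2 → ℝ)),
      (⋂ q ∈ ({a₁, a₂, a₃} : Set (Fin 2 → ℝ)) \ {p},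
        Halfsphere K (q - p)).Nonempty) :
    ∃ c : Fin 2 → ℝ,
      {x : Fin 2 → ℝ | gauge K (x - a₁) = gauge K (x - a₂) ∧
        gauge K (x - a₂) = gauge K (x - a₃)} = {c} := by

  obtain ⟨s, rfl⟩ := hK
  have hmem : ∀ i, ![a₁, a₂, a₃] i ∈ ({a₁, a₂, a₃} : Set (Fin 2 → ℝ)) := by
    intro i; fin_cases i <;> simp
  have hinj : ∀ i j, i ≠ j → ![a₁, a₂, a₃] i ≠ ![a₁, a₂, a₃] j := by
    intro i j hij
    fin_cases i <;> fin_cases j <;> simp_all [Ne.symm]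
  have hx : ∀ i, ∃ x, ∀ j, i ≠ j →
      x ∈ Halfsphere (convexHull ℝ (s : Set (Fin 2 → ℝ))) (![a₁, a₂, a₃] j - ![a₁, a₂, a₃] i) := by
    intro i
    obtain ⟨x, hx⟩ := hsec _ (hmem i)
    refine ⟨x, fun j hij => ?_⟩
    simp only [Set.mem_iInter] at hx
    exact hx _ ⟨hmem j, fun h => hinj i j hij (Set.mem_singleton_iff.1 h).symm⟩
  choose x hx using hx
  obtain ⟨c, hc⟩ := ThreePoint.main_aux _ (convex_convexHull ℝ _)
    (s.finite_toSet.isCompact_convexHull ℝ) h0 ![a₁, a₂, a₃] hinj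
    (fun i j hij => hwgp _ (hmem i) _ (hmem j) (hinj i j hij)) x hx
  refine ⟨c, ?_⟩
  ext z
  rw [Set.mem_singleton_iff, ← hc z]
  constructor
  · rintro ⟨h1, h2⟩ i
    fin_cases i
    · rfl
    · exact h1.symm
    · exact (h1.trans h2).symm
  · intro h
    have h1 := h 1
    have h2 := h 2
    simp only [Matrix.cons_val_zero, Matrix.cons_val_one, Matrix.cons_val] at h1 h2
    exact ⟨h1.symm, h1.trans h2.symm⟩
end

section
/- Let S = {a_1, a_2, a_3} ⊂ R^d be three distinct points in weak general position with respect to a polytope K with 0 in its interior. If H_S(a_i) ≠ ∅ for i = 1,2,3, then bis(a_1,a_2,a_3) is homeomorphic to a non-empty open subset of R^{d-2}. -/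
section Core
open Set Filter Topology

variable {F : Type*} [NormedAddCommGroup F] [NormedSpace ℝ F]

/-- lower end of the chord of `K` through `z` in direction `e` -/
noncomputable def chLo (K : Set F) (e z : F) : ℝ := sInf {t : ℝ | z + t • e ∈ K}
/-- upper end of the chord of `K` through `z` in direction `e` -/
noncomputable def chHi (K : Set F) (e z : F) : ℝ := sSup {t : ℝ | z + t • e ∈ K}
/-- points whose `e`-line meets the interior -/
def chDom (K : Set F) (e : F) : Set F := {z | ∃ t : ℝ, z + t • e ∈ interior K}
/-- apex of the triangle erected on the chord -/
noncomputable def chApex (K : Set F) (e f z : F) : F :=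
  z + chLo K e z • e + (chHi K e z - chLo K e z) • f
/-- strictness in direction `e` -/
def StrictDir (K : Set F) (e : F) : Prop :=
  ∀ z ∈ K, ∀ t : ℝ, 0 < t → z + t • e ∈ K → ∀ τ : ℝ, 0 < τ → τ < t → z + τ • e ∈ interior K

/-- open set of apexes outside `K` with the other two vertices inside -/
def nSet (K : Set F) (e f : F) : Set F :=
  {z | z ∉ K ∧ ∃ l : ℝ, 0 < l ∧ z + l • e ∈ interior K ∧ z + l • f ∈ interior K}

/-- inscribed homothets -/
def inscr (K : Set F) (e f : F) : Set (F × ℝ) :=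
  {q | 0 < q.2 ∧ q.1 ∈ frontier K ∧ q.1 + q.2 • e ∈ frontier K ∧ q.1 + q.2 • f ∈ frontier K}

/-- interior points on open segments, affine-line version -/
lemma line_int {K : Set F} (hc : Convex ℝ K) {z e : F} {a b t : ℝ}
    (ha : z + a • e ∈ interior K) (hb : z + b • e ∈ K) (h1 : (a ≤ t ∧ t < b) ∨ (b < t ∧ t ≤ a)) :
    z + t • e ∈ interior K := by
  have hab : b - a ≠ 0 := by rcases h1 with h | h <;> intro h' <;> linarith [h.1, h.2]
  have key : z + t • e = ((b - t)/(b-a)) • (z + a • e) + ((t-a)/(b-a)) • (z + b • e) := by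
    have : (b - t)/(b-a) + (t-a)/(b-a) = 1 := by field_simp; ring
    have h2 : ((b - t)/(b-a)) * a + ((t-a)/(b-a)) * b = t := by field_simp; ring
    rw [smul_add, smul_add, smul_smul, smul_smul]
    calc z + t • e = ((b - t)/(b-a) + (t-a)/(b-a)) • z +
        (((b - t)/(b-a)) * a + ((t-a)/(b-a)) * b) • e := by rw [this, h2, one_smul]
      _ = _ := by module
  rw [key]
  apply hc.combo_interior_self_mem_interior ha hb
  · rcases h1 with h | h
    · apply div_pos <;> linarith [h.1, h.2]
    · apply div_pos_of_neg_of_neg <;> linarith [h.1, h.2]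
  · rcases h1 with h | h
    · apply div_nonneg <;> linarith [h.1, h.2]
    · apply div_nonneg_of_nonpos <;> linarith [h.1, h.2]
  · field_simp; ring

lemma line_mem {K : Set F} (hc : Convex ℝ K) {z e : F} {a b t : ℝ}
    (ha : z + a • e ∈ K) (hb : z + b • e ∈ K) (h1 : a ≤ t) (h2 : t ≤ b) :
    z + t • e ∈ K := by
  rcases eq_or_lt_of_le (h1.trans h2) with h | h
  · have : t = a := by linarith
    rwa [this]
  have hab : b - a ≠ 0 := by intro h'; linarith
  have key : z + t • e = ((b - t)/(b-a)) • (z + a • e) + ((t-a)/(b-a)) • (z + b • e) := by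
    have : (b - t)/(b-a) + (t-a)/(b-a) = 1 := by field_simp; ring
    have h2 : ((b - t)/(b-a)) * a + ((t-a)/(b-a)) * b = t := by field_simp; ring
    rw [smul_add, smul_add, smul_smul, smul_smul]
    calc z + t • e = ((b - t)/(b-a) + (t-a)/(b-a)) • z +
        (((b - t)/(b-a)) * a + ((t-a)/(b-a)) * b) • e := by rw [this, h2, one_smul]
      _ = _ := by module
  rw [key]
  apply hc ha hb
  · apply div_nonneg <;> linarith
  · apply div_nonneg <;> linarith
  · field_simp; ring

lemma line_open {U : Set F} (hU : IsOpen U) {z : F} (e : F) (hz : z ∈ U) :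
    ∃ ε > 0, ∀ t : ℝ, |t| < ε → z + t • e ∈ U := by
  have hcont : ContinuousAt (fun t : ℝ => z + t • e) 0 := by fun_prop
  have : ∀ᶠ t in 𝓝 (0:ℝ), z + t • e ∈ U := by
    apply hcont
    simpa using hU.mem_nhds hz
  obtain ⟨ε, hε, h⟩ := Metric.eventually_nhds_iff.1 this
  exact ⟨ε, hε, fun t ht => h (by simpa [Real.dist_eq] using ht)⟩

lemma chord_spec {K : Set F} (hc : Convex ℝ K) (hcl : IsClosed K) (hb : Bornology.IsBounded K)
    {e : F} (he : e ≠ 0) {z : F} (hz : z ∈ chDom K e) :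
    chLo K e z < chHi K e z ∧
    (∀ t : ℝ, z + t • e ∈ K ↔ chLo K e z ≤ t ∧ t ≤ chHi K e z) ∧
    (∀ t : ℝ, z + t • e ∈ interior K ↔ chLo K e z < t ∧ t < chHi K e z) := by
  obtain ⟨t0, ht0⟩ := hz
  set S : Set ℝ := {t : ℝ | z + t • e ∈ K} with hS
  have hne : S.Nonempty := ⟨t0, show z + t0 • e ∈ K from interior_subset ht0⟩
  have hScl : IsClosed S := hcl.preimage (by fun_prop)
  have hSb : Bornology.IsBounded S := by
    obtain ⟨C, hC⟩ := hb.exists_norm_le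
    rw [isBounded_iff_forall_norm_le]
    refine ⟨(C + ‖z‖) / ‖e‖, fun t ht => ?_⟩
    have hpos : 0 < ‖e‖ := norm_pos_iff.2 he
    rw [le_div_iff₀ hpos, ← norm_smul]
    have : t • e = (z + t • e) - z := by abel
    rw [this]
    exact (norm_sub_le _ _).trans (by linarith [hC _ ht])
  have hSa : BddAbove S := hSb.bddAbove
  have hSbl : BddBelow S := hSb.bddBelow
  have hlo : chLo K e z ∈ S := hScl.csInf_mem hne hSbl
  have hhi : chHi K e z ∈ S := hScl.csSup_mem hne hSa
  have hmem : ∀ t : ℝ, z + t • e ∈ K ↔ chLo K e z ≤ t ∧ t ≤ chHi K e z := by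
    intro t
    constructor
    · intro h
      exact ⟨csInf_le hSbl h, le_csSup hSa h⟩
    · rintro ⟨h1, h2⟩
      exact line_mem hc hlo hhi h1 h2
  have hint : ∀ t : ℝ, z + t • e ∈ interior K ↔ chLo K e z < t ∧ t < chHi K e z := by
    have fwd : ∀ t : ℝ, z + t • e ∈ interior K → chLo K e z < t ∧ t < chHi K e z := by
      intro t h
      obtain ⟨ε, hε, hh⟩ := line_open isOpen_interior e h
      have h1 := hh (ε/2) (by rw [abs_of_pos] <;> linarith)
      have h2 := hh (-(ε/2)) (by rw [abs_neg, abs_of_pos] <;> linarith)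
      rw [add_assoc, ← add_smul] at h1 h2
      have h1' := (hmem _).1 (interior_subset h1)
      have h2' := (hmem _).1 (interior_subset h2)
      constructor <;> linarith [h1'.1, h1'.2, h2'.1, h2'.2]
    intro t
    refine ⟨fwd t, fun ⟨h1, h2⟩ => ?_⟩
    rcases le_total t0 t with h | h
    · exact line_int hc ht0 hhi (Or.inl ⟨h, h2⟩)
    · exact line_int hc ht0 hlo (Or.inr ⟨h1, h⟩)
  refine ⟨?_, hmem, hint⟩
  have := (hint t0).1 ht0
  linarith [this.1, this.2]

lemma chDom_open (K : Set F) (e : F) : IsOpen (chDom K e) := by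
  have : chDom K e = ⋃ t : ℝ, (fun z => z + t • e) ⁻¹' interior K := by
    ext z; simp [chDom]
  rw [this]
  exact isOpen_iUnion fun t => isOpen_interior.preimage (by fun_prop)

lemma chDom_convex {K : Set F} (hc : Convex ℝ K) (e : F) : Convex ℝ (chDom K e) := by
  rintro x ⟨s, hs⟩ y ⟨t, ht⟩ a b ha hb hab
  refine ⟨a * s + b * t, ?_⟩
  have := hc.interior hs ht ha hb hab
  convert this using 1
  module

lemma chHi_cont {K : Set F} (hc : Convex ℝ K) (hcl : IsClosed K) (hb : Bornology.IsBounded K)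
    {e : F} (he : e ≠ 0) {z : F} (hz : z ∈ chDom K e) : ContinuousAt (chHi K e) z := by
  obtain ⟨h1, h2, h3⟩ := chord_spec hc hcl hb he hz
  have hdom : ∀ᶠ z' in 𝓝 z, z' ∈ chDom K e := (chDom_open K e).mem_nhds hz
  have hin : ∀ t : ℝ, z + t • e ∈ interior K → ∀ᶠ z' in 𝓝 z, z' + t • e ∈ interior K := by
    intro t ht
    have : ContinuousAt (fun z' : F => z' + t • e) z := by fun_prop
    exact this (isOpen_interior.mem_nhds ht)
  have hout : ∀ t : ℝ, z + t • e ∉ K → ∀ᶠ z' in 𝓝 z, z' + t • e ∉ K := by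
    intro t ht
    have : ContinuousAt (fun z' : F => z' + t • e) z := by fun_prop
    exact this (hcl.isOpen_compl.mem_nhds ht)
  refine tendsto_order.2 ⟨fun a ha => ?_, fun a ha => ?_⟩
  · obtain ⟨t, ht1, ht2⟩ := exists_between (max_lt ha h1)
    filter_upwards [hdom, hin t ((h3 t).2 ⟨(le_max_right _ _).trans_lt ht1, ht2⟩)] with z' hz' hzt
    have := ((chord_spec hc hcl hb he hz').2.2 t).1 hzt
    exact (le_max_left _ _).trans_lt (ht1.trans this.2)
  · obtain ⟨t, ht1, ht2⟩ := exists_between h1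
    filter_upwards [hdom, hin t ((h3 t).2 ⟨ht1, ht2⟩), hout a (fun h => by
      have := ((h2 a).1 h).2; linarith)] with z' hz' hzt hza
    obtain ⟨g1, g2, g3⟩ := chord_spec hc hcl hb he hz'
    by_contra hcon
    push Not at hcon
    apply hza
    refine (g2 a).2 ⟨?_, hcon⟩
    have := ((g3 t).1 hzt).1
    linarith

lemma chLo_cont {K : Set F} (hc : Convex ℝ K) (hcl : IsClosed K) (hb : Bornology.IsBounded K)
    {e : F} (he : e ≠ 0) {z : F} (hz : z ∈ chDom K e) : ContinuousAt (chLo K e) z := by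
  obtain ⟨h1, h2, h3⟩ := chord_spec hc hcl hb he hz
  have hdom : ∀ᶠ z' in 𝓝 z, z' ∈ chDom K e := (chDom_open K e).mem_nhds hz
  have hin : ∀ t : ℝ, z + t • e ∈ interior K → ∀ᶠ z' in 𝓝 z, z' + t • e ∈ interior K := by
    intro t ht
    have : ContinuousAt (fun z' : F => z' + t • e) z := by fun_prop
    exact this (isOpen_interior.mem_nhds ht)
  have hout : ∀ t : ℝ, z + t • e ∉ K → ∀ᶠ z' in 𝓝 z, z' + t • e ∉ K := by
    intro t ht
    have : ContinuousAt (fun z' : F => z' + t • e) z := by fun_prop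
    exact this (hcl.isOpen_compl.mem_nhds ht)
  refine tendsto_order.2 ⟨fun a ha => ?_, fun a ha => ?_⟩
  · obtain ⟨t, ht1, ht2⟩ := exists_between h1
    filter_upwards [hdom, hin t ((h3 t).2 ⟨ht1, ht2⟩), hout a (fun h => by
      have := ((h2 a).1 h).1; linarith)] with z' hz' hzt hza
    obtain ⟨g1, g2, g3⟩ := chord_spec hc hcl hb he hz'
    by_contra hcon
    push Not at hcon
    apply hza
    refine (g2 a).2 ⟨hcon, ?_⟩
    have := ((g3 t).1 hzt).2
    linarith
  · obtain ⟨t, ht1, ht2⟩ := exists_between (lt_min ha h1)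
    filter_upwards [hdom, hin t ((h3 t).2 ⟨ht1, ht2.trans_le (min_le_right _ _)⟩)] with z' hz' hzt
    have := ((chord_spec hc hcl hb he hz').2.2 t).1 hzt
    exact this.1.trans (ht2.trans_le (min_le_left _ _))

lemma chApex_cont {K : Set F} (hc : Convex ℝ K) (hcl : IsClosed K) (hb : Bornology.IsBounded K)
    {e : F} (he : e ≠ 0) (f : F) {z : F} (hz : z ∈ chDom K e) :
    ContinuousAt (chApex K e f) z := by
  have h1 := chHi_cont hc hcl hb he hz
  have h2 := chLo_cont hc hcl hb he hz
  unfold chApex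
  fun_prop

lemma chord_frontier {K : Set F} (hc : Convex ℝ K) (hcl : IsClosed K) (hb : Bornology.IsBounded K)
    {e : F} (he : e ≠ 0) {z : F} (hz : z ∈ chDom K e) :
    z + chLo K e z • e ∈ frontier K ∧ z + chHi K e z • e ∈ frontier K := by
  obtain ⟨h1, h2, h3⟩ := chord_spec hc hcl hb he hz
  rw [hcl.frontier_eq]
  exact ⟨⟨(h2 _).2 ⟨le_rfl, h1.le⟩, fun h => lt_irrefl _ ((h3 _).1 h).1⟩,
    ⟨(h2 _).2 ⟨h1.le, le_rfl⟩, fun h => lt_irrefl _ ((h3 _).1 h).2⟩⟩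

/-- two frontier points with interior between determine the chord -/
lemma chord_eq {K : Set F} (hc : Convex ℝ K) (hcl : IsClosed K) (hb : Bornology.IsBounded K)
    {e : F} (he : e ≠ 0) {z : F} {a b : ℝ} (hab : a < b)
    (hz : z ∈ chDom K e)
    (ha : z + a • e ∈ frontier K) (hb' : z + b • e ∈ frontier K) :
    chLo K e z = a ∧ chHi K e z = b := by
  obtain ⟨h1, h2, h3⟩ := chord_spec hc hcl hb he hz
  rw [hcl.frontier_eq] at ha hb'
  have a1 := (h2 a).1 ha.1
  have b1 := (h2 b).1 hb'.1
  have a2 : ¬ _ := fun h => ha.2 ((h3 a).2 h)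
  have b2 : ¬ _ := fun h => hb'.2 ((h3 b).2 h)
  have a3 : chLo K e z = a := by
    by_contra hne
    exact a2 ⟨lt_of_le_of_ne a1.1 hne, by linarith [b1.2]⟩
  refine ⟨a3, ?_⟩
  by_contra hne
  exact b2 ⟨by linarith, lt_of_le_of_ne b1.2 (Ne.symm hne)⟩

lemma inscr_of_apex {K : Set F} (hc : Convex ℝ K) (hcl : IsClosed K)
    (hb : Bornology.IsBounded K)
    {e f : F} (he : e ≠ 0) {z : F} (hz : z ∈ chDom K e) (hR : chApex K e f z ∈ frontier K) :
    (z + chLo K e z • e, chHi K e z - chLo K e z) ∈ inscr K e f := by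
  obtain ⟨h1, -, -⟩ := chord_spec hc hcl hb he hz
  obtain ⟨h2, h3⟩ := chord_frontier hc hcl hb he hz
  refine ⟨by simpa using h1, h2, ?_, hR⟩
  convert h3 using 1
  simp only; module

lemma inscr_swap {K : Set F} {e f : F} {q : F × ℝ} (h : q ∈ inscr K e f) : q ∈ inscr K f e :=
  ⟨h.1, h.2.1, h.2.2.2, h.2.2.1⟩

/-- Intermediate value argument -/
lemma ivt {K : Set F} (hc : Convex ℝ K) (hcl : IsClosed K)
    (hb : Bornology.IsBounded K)
    {e f : F} (he : e ≠ 0) {z0 z1 : F} (hz0 : z0 ∈ chDom K e) (hz1 : z1 ∈ chDom K e)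
    (h0 : chApex K e f z0 ∉ K) (h1 : chApex K e f z1 ∈ K) :
    ∃ z ∈ segment ℝ z0 z1, z ∈ chDom K e ∧ chApex K e f z ∈ frontier K := by
  have hsub : segment ℝ z0 z1 ⊆ chDom K e := (chDom_convex hc e).segment_subset hz0 hz1
  have hpre : IsPreconnected (chApex K e f '' segment ℝ z0 z1) := by
    apply (convex_segment z0 z1).isPreconnected.image
    intro z hz
    exact (chApex_cont hc hcl hb he f (hsub hz)).continuousWithinAt
  by_contra hcon
  push Not at hcon
  have hnf : ∀ z ∈ segment ℝ z0 z1, chApex K e f z ∈ K → chApex K e f z ∈ interior K := by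
    intro z hz hK
    by_contra h
    exact hcon z hz (hsub hz) (by rw [hcl.frontier_eq]; exact ⟨hK, h⟩)
  have := hpre (interior K) Kᶜ isOpen_interior hcl.isOpen_compl (by
      rintro _ ⟨z, hz, rfl⟩
      by_cases h : chApex K e f z ∈ K
      · exact Or.inl (hnf z hz h)
      · exact Or.inr h)
    ⟨_, mem_image_of_mem _ (right_mem_segment ℝ z0 z1), hnf _ (right_mem_segment ℝ z0 z1) h1⟩
    ⟨_, mem_image_of_mem _ (left_mem_segment ℝ z0 z1), h0⟩
  obtain ⟨y, -, hy1, hy2⟩ := this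
  exact hy2 (interior_subset hy1)

end Core
section Core2
open Set Filter Topology

variable {F : Type*} [NormedAddCommGroup F] [NormedSpace ℝ F]

/-- shifting along `e` shifts the chord -/
lemma chDom_shift {K : Set F} {e z : F} (t : ℝ) (hz : z ∈ chDom K e) : z + t • e ∈ chDom K e := by
  obtain ⟨s, hs⟩ := hz
  refine ⟨s - t, ?_⟩
  convert hs using 1
  module

/-- The monotonicity lemma. -/
lemma mono {K : Set F} (hc : Convex ℝ K) (hcl : IsClosed K) (hb : Bornology.IsBounded K)
    {e f : F} (he : e ≠ 0) (We : StrictDir K e) (Wf : StrictDir K f) (Wfe : StrictDir K (f - e))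
    {z : F} {d t : ℝ} (hd : 0 < d) (hz : z ∈ chDom K e) (hz' : z + d • f + t • e ∈ chDom K e)
    (hR : chApex K e f (z + d • f + t • e) ∈ K) : chApex K e f z ∈ interior K := by
  obtain ⟨h1, h2, h3⟩ := chord_spec hc hcl hb he hz
  obtain ⟨g1, g2, g3⟩ := chord_spec hc hcl hb he hz'
  unfold chApex at hR ⊢
  set A := chLo K e z
  set B := chHi K e z
  set A' := chLo K e (z + d • f + t • e)
  set B' := chHi K e (z + d • f + t • e)
  obtain ⟨p, hp⟩ : ∃ p, p = z + A • e := ⟨_, rfl⟩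
  obtain ⟨a, ha⟩ : ∃ a, a = A' + t - A := ⟨_, rfl⟩
  obtain ⟨l, hl⟩ : ∃ l, l = B - A := ⟨_, rfl⟩
  obtain ⟨l', hl'⟩ : ∃ l', l' = B' - A' := ⟨_, rfl⟩
  have hl0 : 0 < l := by linarith
  have hl0' : 0 < l' := by linarith
  have hP : p ∈ K := by rw [hp]; exact (h2 A).2 ⟨le_rfl, h1.le⟩
  have hQ : p + l • e ∈ K := by
    have := (h2 B).2 ⟨h1.le, le_rfl⟩
    convert this using 1; rw [hp, hl]; module
  -- description of the upper chord
  have hC : ∀ s : ℝ, p + d • f + s • e ∈ K ↔ a ≤ s ∧ s ≤ a + l' := by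
    intro s
    have := g2 (s + A - t)
    have e1 : z + d • f + t • e + (s + A - t) • e = p + d • f + s • e := by rw [hp]; module
    rw [e1] at this
    rw [this, ha, hl']
    constructor <;> rintro ⟨x, y⟩ <;> constructor <;> linarith
  have hCi : ∀ s : ℝ, p + d • f + s • e ∈ interior K ↔ a < s ∧ s < a + l' := by
    intro s
    have := g3 (s + A - t)
    have e1 : z + d • f + t • e + (s + A - t) • e = p + d • f + s • e := by rw [hp]; module
    rw [e1] at this
    rw [this, ha, hl']
    constructor <;> rintro ⟨x, y⟩ <;> constructor <;> linarith
  have hR' : p + (d + l') • f + a • e ∈ K := by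
    convert hR using 1; rw [hp, ha, hl']; module
  have hP' : p + d • f + a • e ∈ K := (hC a).2 ⟨le_rfl, by linarith⟩
  have hQ' : p + d • f + (a + l') • e ∈ K := (hC _).2 ⟨by linarith, le_rfl⟩
  have hdl : 0 < d + l' := by linarith
  clear_value A B A' B'
  have ha0 : a < 0 := by
    by_contra hcon
    push Not at hcon
    rcases eq_or_lt_of_le hcon with h | h
    · have := Wf p hP (d + l') hdl (by convert hR' using 1; rw [← h]; module) d hd (by linarith)
      have h5 := (hCi 0).1 (by convert this using 1; module)
      linarith [h5.1]
    · have := hc hP hR' (a := l' / (d + l')) (b := d / (d + l')) (by positivity) (by positivity)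
        (by field_simp; ring)
      have h5 := (hC (d / (d + l') * a)).1 (by
        convert this using 1
        have e1 : d / (d + l') * (d + l') = d := by field_simp
        have e2 : l' / (d + l') + d / (d + l') = 1 := by field_simp; ring
        calc p + d • f + (d / (d + l') * a) • e = (l' / (d + l') + d / (d + l')) • p
            + (d / (d + l') * (d + l')) • f + (d / (d + l') * a) • e := by rw [e1, e2, one_smul]
          _ = _ := by module)
      have h6 : d / (d + l') < 1 := by rw [div_lt_one hdl]; linarith
      nlinarith [h5.1]
  have hb0 : l - a < d + l' := by
    by_contra hcon
    push Not at hcon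
    rcases eq_or_lt_of_le hcon with h | h
    · have := Wfe (p + l • e) hQ (d + l') hdl (by
        convert hR' using 1
        have : l = a + (d + l') := by linarith
        rw [this]; module) d hd (by linarith)
      have h5 := (hCi (a + l')).1 (by
        convert this using 1
        have : l = a + (d + l') := by linarith
        rw [this]; module)
      linarith [h5.2]
    · have := hc hQ hR' (a := l' / (d + l')) (b := d / (d + l')) (by positivity) (by positivity)
        (by field_simp; ring)
      have h5 := (hC (l' / (d + l') * l + d / (d + l') * a)).1 (by
        convert this using 1
        have e1 : d / (d + l') * (d + l') = d := by field_simp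
        have e2 : l' / (d + l') + d / (d + l') = 1 := by field_simp; ring
        calc p + d • f + (l' / (d + l') * l + d / (d + l') * a) • e
            = (l' / (d + l') + d / (d + l')) • p
            + (d / (d + l') * (d + l')) • f + (l' / (d + l') * l + d / (d + l') * a) • e := by
              rw [e1, e2, one_smul]
          _ = _ := by module)
      have h6 := h5.2
      have h7 : l' / (d + l') * l + d / (d + l') * a - a = l' / (d + l') * (l - a) := by
        field_simp; ring
      have h8 : l' / (d + l') * (l - a) ≤ l' := by linarith
      rw [div_mul_eq_mul_div, div_le_iff₀ hdl] at h8
      nlinarith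
  have goal' : p + l • f ∈ interior K := by
    rcases le_or_gt l d with hld | hld
    · -- below the upper chord
      set θ := l / d with hθ
      have hθ0 : 0 < θ := by positivity
      have hθ1 : θ ≤ 1 := by rw [hθ, div_le_one hd]; exact hld
      have hθd : θ * d = l := by rw [hθ]; field_simp
      have hL := hc hP hP' (a := 1 - θ) (b := θ) (by linarith) hθ0.le (by ring)
      have hRt := hc hQ hQ' (a := 1 - θ) (b := θ) (by linarith) hθ0.le (by ring)
      have eL : (1 - θ) • p + θ • (p + d • f + a • e) = p + l • f + (θ * a) • e := by
        rw [← hθd]; module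
      have eR : (1 - θ) • (p + l • e) + θ • (p + d • f + (a + l') • e)
          = p + l • f + (θ * a) • e + ((1 - θ) * l + θ * l') • e := by
        rw [← hθd]; module
      rw [eL] at hL
      rw [eR] at hRt
      have hθa : θ * a < 0 := by nlinarith
      have key : 0 < (1 - θ) * l + θ * (a + l') := by nlinarith
      have := We _ hL ((1 - θ) * l + θ * l') (by nlinarith) hRt (-(θ * a)) (by linarith)
        (by linarith)
      convert this using 1
      module
    · obtain ⟨m, hm⟩ : ∃ m, m = l - d := ⟨_, rfl⟩
      have hm0 : 0 < m := by linarith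
      have hm1 : m - a < l' := by linarith
      have hL := hc hP' hR' (a := 1 - m / l') (b := m / l')
        (by rw [sub_nonneg, div_le_one hl0']; linarith) (by positivity) (by ring)
      have hRt := hc hQ' hR' (a := 1 - m / l') (b := m / l')
        (by rw [sub_nonneg, div_le_one hl0']; linarith) (by positivity) (by ring)
      have hml : m / l' * l' = m := by field_simp
      have eL : (1 - m / l') • (p + d • f + a • e) + (m / l') • (p + (d + l') • f + a • e)
          = p + (d + m) • f + a • e := by
        nth_rewrite 3 [← hml]; module
      have eR : (1 - m / l') • (p + d • f + (a + l') • e) + (m / l') • (p + (d + l') • f + a • e)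
          = p + (d + m) • f + a • e + (l' - m) • e := by
        nth_rewrite 3 4 [← hml]; module
      rw [eL] at hL
      rw [eR] at hRt
      have := We _ hL (l' - m) (by linarith) hRt (-a) (by linarith) (by linarith)
      convert this using 1
      rw [hm]; module
  convert goal' using 1
  rw [hp, hl]

/-- Lemma A -/
lemma nSet_of_frontier {K : Set F} (hc : Convex ℝ K) (hcl : IsClosed K) {e f z : F}
    (hz : z ∈ frontier K) {t t' : ℝ} (ht : 0 < t) (ht' : 0 < t')
    (h1 : z + t • e ∈ interior K) (h2 : z + t' • f ∈ interior K) :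
    ∃ ε : ℝ, z + ε • e ∈ nSet K e f := by
  rw [hcl.frontier_eq] at hz
  have hm : 0 < min t t' := lt_min ht ht'
  have hz0 : ∀ g : F, z + (0:ℝ) • g ∈ K := fun g => by simpa using hz.1
  have h1' : z + (min t t') • e ∈ interior K :=
    line_int hc h1 (hz0 e) (Or.inr ⟨hm, min_le_left _ _⟩)
  have h2' : z + (min t t') • f ∈ interior K :=
    line_int hc h2 (hz0 f) (Or.inr ⟨hm, min_le_right _ _⟩)
  obtain ⟨ε1, hε1, k1⟩ := line_open isOpen_interior e h1'
  obtain ⟨ε2, hε2, k2⟩ := line_open isOpen_interior e h2'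
  set ε := min ε1 ε2 / 2 with hε
  have hε0 : 0 < ε := by have := lt_min hε1 hε2; positivity
  have hεε1 : |-ε| < ε1 := by
    rw [abs_neg, abs_of_pos hε0]; have := min_le_left ε1 ε2; linarith
  have hεε2 : |-ε| < ε2 := by
    rw [abs_neg, abs_of_pos hε0]; have := min_le_right ε1 ε2; linarith
  refine ⟨-ε, fun hK => hz.2 ?_, min t t', hm, ?_, ?_⟩
  · have := line_int hc h1 hK (t := 0) (Or.inr ⟨by linarith, ht.le⟩)
    simpa using this
  · convert k1 (-ε) hεε1 using 1; module
  · convert k2 (-ε) hεε2 using 1; module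

lemma nSet_comm (K : Set F) (e f : F) : nSet K e f = nSet K f e := by
  ext z; simp only [nSet, mem_ofPred_eq]; tauto

lemma nSet_open {K : Set F} (hcl : IsClosed K) (e f : F) : IsOpen (nSet K e f) := by
  have : nSet K e f = Kᶜ ∩ ⋃ l : ℝ, ⋃ _ : 0 < l,
      ((fun z => z + l • e) ⁻¹' interior K ∩ (fun z => z + l • f) ⁻¹' interior K) := by
    ext z; simp [nSet]; intro _; refine exists_congr fun l => ?_; tauto
  rw [this]
  refine hcl.isOpen_compl.inter (isOpen_iUnion fun l => isOpen_iUnion fun _ => ?_)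
  exact (isOpen_interior.preimage (by fun_prop)).inter (isOpen_interior.preimage (by fun_prop))

/-- points of the plane through `z` -/
def samePlane (e f z w : F) : Prop := ∃ s t : ℝ, w = z + s • e + t • f

/-- two out of three -/
lemma two_of_three {K : Set F} (hc : Convex ℝ K) (hcl : IsClosed K) (hb : Bornology.IsBounded K)
    {e f : F} (he : e ≠ 0) (Wf : StrictDir K f) (Wfe : StrictDir K (f - e))
    {z : F} (hz : z ∈ interior K) :
    (∃ w ∈ nSet K (-f) (e - f), samePlane e f z w) ∨
    ((∃ w ∈ nSet K e f, samePlane e f z w) ∧ ∃ w ∈ nSet K (-e) (f - e), samePlane e f z w) := by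
  have hzd : z ∈ chDom K e := ⟨0, by simpa using hz⟩
  obtain ⟨h1, h2, h3⟩ := chord_spec hc hcl hb he hzd
  obtain ⟨hPf, hQf⟩ := chord_frontier hc hcl hb he hzd
  set A := chLo K e z
  set B := chHi K e z
  obtain ⟨l, hl⟩ : ∃ l, l = B - A := ⟨_, rfl⟩
  have hl0 : 0 < l := by linarith
  obtain ⟨p, hp⟩ : ∃ p, p = z + A • e := ⟨_, rfl⟩
  have hmid : ∀ t : ℝ, 0 < t → t < l → p + t • e ∈ interior K := by
    intro t ht htl
    have := (h3 (A + t)).2 ⟨by linarith, by linarith⟩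
    convert this using 1; rw [hp]; module
  have hP : p ∈ frontier K := by rw [hp]; exact hPf
  have hQ : p + l • e ∈ frontier K := by convert hQf using 1; rw [hp, hl]; module
  by_cases hR : p + l • f ∈ K
  · by_cases hRi : p + l • f ∈ interior K
    · right
      constructor
      · obtain ⟨ε, hε⟩ := nSet_of_frontier hc hcl (e := e) (f := f) hP (half_pos hl0) hl0
          (hmid _ (half_pos hl0) (by linarith)) hRi
        exact ⟨_, hε, A + ε, 0, by rw [hp]; module⟩
      · obtain ⟨ε, hε⟩ := nSet_of_frontier hc hcl (e := -e) (f := f - e) hQ (half_pos hl0) hl0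
          (by convert hmid _ (half_pos hl0) (by linarith) using 1; module)
          (by convert hRi using 1; module)
        exact ⟨_, hε, A + l - ε, 0, by rw [hp]; module⟩
    · left
      have hRf : p + l • f ∈ frontier K := by rw [hcl.frontier_eq]; exact ⟨hR, hRi⟩
      have i1 := Wf p (hcl.frontier_subset hP) l hl0 hR (l/2) (half_pos hl0) (by linarith)
      have i2 := Wfe _ (hcl.frontier_subset hQ) l hl0 (by convert hR using 1; module)
        (l/2) (half_pos hl0) (by linarith)
      obtain ⟨ε, hε⟩ := nSet_of_frontier hc hcl (e := -f) (f := e - f) hRf (half_pos hl0)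
        (half_pos hl0) (by convert i1 using 1; module) (by convert i2 using 1; module)
      exact ⟨_, hε, A, l - ε, by rw [hp]; module⟩
  · left
    have hcont : ContinuousAt (fun ε : ℝ => p + ε • e + (l - 2 * ε) • f) 0 := by fun_prop
    have hev : ∀ᶠ ε in 𝓝 (0:ℝ), p + ε • e + (l - 2 * ε) • f ∈ Kᶜ := by
      apply hcont
      apply hcl.isOpen_compl.mem_nhds
      simpa using hR
    obtain ⟨δ, hδ, h⟩ := Metric.eventually_nhds_iff.1 hev
    obtain ⟨ε, hε0, hε⟩ := exists_between (lt_min hδ (show 0 < l / 2 by positivity))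
    have hε1 := hε.trans_le (min_le_left _ _)
    have hε2 := hε.trans_le (min_le_right _ _)
    have hout := h (y := ε) (by simpa [Real.dist_eq, abs_of_pos hε0] using hε1)
    refine ⟨p + ε • e + (l - 2 * ε) • f, ⟨hout, l - 2 * ε, by linarith, ?_, ?_⟩,
      A + ε, l - 2 * ε, by rw [hp]; module⟩
    · convert hmid ε hε0 (by linarith) using 1; module
    · convert hmid (l - ε) (by linarith) (by linarith) using 1; module

lemma apex_out {K : Set F} (hc : Convex ℝ K) (hcl : IsClosed K) (hb : Bornology.IsBounded K)
    {e f : F} (he : e ≠ 0) {w : F} (hw : w ∈ nSet K (-f) (e - f)) :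
    ∃ t : ℝ, w + t • f ∈ chDom K e ∧ chApex K e f (w + t • f) ∉ K := by
  obtain ⟨hwK, l, hl, h1, h2⟩ := hw
  have hd : w + (-l) • f ∈ chDom K e := ⟨0, by convert h1 using 1; module⟩
  refine ⟨-l, hd, fun hR => hwK ?_⟩
  obtain ⟨g1, g2, g3⟩ := chord_spec hc hcl hb he hd
  obtain ⟨hPf, hQf⟩ := chord_frontier hc hcl hb he hd
  have hP := hcl.frontier_subset hPf
  have hQ := hcl.frontier_subset hQf
  have a1 := (g3 0).1 (by convert h1 using 1; module)
  have a2 := (g3 l).1 (by convert h2 using 1; module)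
  unfold chApex at hR
  set A := chLo K e (w + (-l) • f)
  set B := chHi K e (w + (-l) • f)
  have hBA : 0 < B - A := by linarith
  -- barycentric coordinates
  have hconv := hc.sum_mem (t := Finset.univ) (w := ![(B - l) / (B - A), -A / (B - A), l / (B - A)])
    (z := ![w + (-l) • f + A • e, w + (-l) • f + B • e,
      w + (-l) • f + A • e + (B - A) • f])
    (by
      intro i _
      fin_cases i
      · exact div_nonneg (by linarith) hBA.le
      · exact div_nonneg (by linarith [a1.1]) hBA.le
      · exact div_nonneg hl.le hBA.le)
    (by
      have := hBA.ne'
      simp [Fin.sum_univ_three]; field_simp; ring)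
    (by
      intro i _
      fin_cases i
      · exact hP
      · exact hQ
      · exact hR)
  have hne := hBA.ne'
  convert hconv using 1
  simp only [Fin.sum_univ_three, Matrix.cons_val_zero, Matrix.cons_val_one, Matrix.cons_val]
  have e1 : (B - l) / (B - A) + -A / (B - A) + l / (B - A) = 1 := by field_simp; ring
  have e2 : ((B - l) / (B - A) + -A / (B - A) + l / (B - A)) * (-l) + l / (B - A) * (B - A) = 0 := by
    field_simp; ring
  have e3 : (B - l) / (B - A) * A + -A / (B - A) * B + l / (B - A) * A = 0 := by
    field_simp; ring
  calc w = (1:ℝ) • w + (0:ℝ) • f + (0:ℝ) • e := by module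
    _ = ((B - l) / (B - A) + -A / (B - A) + l / (B - A)) • w +
        (((B - l) / (B - A) + -A / (B - A) + l / (B - A)) * (-l) + l / (B - A) * (B - A)) • f +
        ((B - l) / (B - A) * A + -A / (B - A) * B + l / (B - A) * A) • e := by rw [e3, e2, e1]
    _ = _ := by module

lemma samePlane_seg {E : Type*} [AddCommGroup E] [Module ℝ E] (π : F →ₗ[ℝ] E) {z0 z1 z : F} {x : E}
    (h0 : π z0 = x) (h1 : π z1 = x) (h : z ∈ segment ℝ z0 z1) : π z = x := by
  obtain ⟨a, b, ha, hb, hab, rfl⟩ := h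
  rw [map_add, map_smul, map_smul, h0, h1, ← add_smul, hab, one_smul]

/-- existence of inscribed triangles -/
lemma exists_inscr {K : Set F} (hc : Convex ℝ K) (hcl : IsClosed K) (hb : Bornology.IsBounded K)
    {e f : F} (he : e ≠ 0) (hf : f ≠ 0) {E : Type*} [AddCommGroup E] [Module ℝ E] (π : F →ₗ[ℝ] E)
    (πe : π e = 0) (πf : π f = 0) {x : E}
    (h1 : x ∈ π '' nSet K e f) (h2 : x ∈ π '' nSet K (-e) (f - e))
    (h3 : x ∈ π '' nSet K (-f) (e - f)) : ∃ q ∈ inscr K e f, π q.1 = x := by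
  by_contra hcon
  push Not at hcon
  have hall3 : ∀ z ∈ chDom K e, π z = x → chApex K e f z ∉ K := by
    intro z hz hzx hK
    obtain ⟨w, hw, hwx⟩ := h3
    obtain ⟨t, hd, hR⟩ := apex_out hc hcl hb he hw
    obtain ⟨y, hy, hyd, hyf⟩ := ivt hc hcl hb he hd hz hR hK
    refine hcon _ (inscr_of_apex hc hcl hb he hyd hyf) ?_
    have : π y = x := samePlane_seg π (by simp [hwx, πf]) hzx hy
    simp [this, πe]
  have hall2 : ∀ z ∈ chDom K f, π z = x → chApex K f e z ∉ K := by
    intro z hz hzx hK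
    obtain ⟨w, hw, hwx⟩ := h2
    obtain ⟨t, hd, hR⟩ := apex_out hc hcl hb hf hw
    obtain ⟨y, hy, hyd, hyf⟩ := ivt hc hcl hb hf hd hz hR hK
    refine hcon _ (inscr_swap (inscr_of_apex hc hcl hb hf hyd hyf)) ?_
    have : π y = x := samePlane_seg π (by simp [hwx, πe]) hzx hy
    simp [this, πf]
  obtain ⟨w, ⟨hwK, l, hl, hwe, hwf⟩, hwx⟩ := h1
  have hwd : w ∈ chDom K e := ⟨l, hwe⟩
  obtain ⟨g1, g2, g3⟩ := chord_spec hc hcl hb he hwd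
  have hPf := (chord_frontier hc hcl hb he hwd).1
  have a1 := (g3 l).1 hwe
  set τ := chLo K e w
  have hτ : 0 < τ := by
    by_contra hneg
    push Not at hneg
    exact hwK (by simpa using (g2 0).2 ⟨hneg, by linarith⟩)
  set p := w + τ • e with hp
  have hpx : π p = x := by simp [hp, hwx, πe]
  have hpf : p + (l - τ) • f ∈ interior K := by
    have := hc.interior hwe hwf (a := τ / l) (b := (l - τ) / l) (by positivity)
      (div_nonneg (by linarith) hl.le) (by field_simp; ring)
    convert this using 1
    have e1 : τ / l + (l - τ) / l = 1 := by field_simp; ring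
    have e2 : τ / l * l = τ := by field_simp
    have e3 : (l - τ) / l * l = l - τ := by field_simp
    calc p + (l - τ) • f = (1:ℝ) • w + τ • e + (l - τ) • f := by rw [hp]; module
      _ = (τ / l + (l - τ) / l) • w + (τ / l * l) • e + ((l - τ) / l * l) • f := by
        rw [e1, e2, e3]
      _ = _ := by module
  have hpe : p + (l - τ) • e ∈ interior K := by convert hwe using 1; rw [hp]; module
  have hlt : 0 < l - τ := by linarith
  clear_value p
  have base : ∀ g : F, g ≠ 0 → p + (l - τ) • g ∈ interior K → p ∈ chDom K g ∧ chLo K g p = 0 ∧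
      0 < chHi K g p ∧ ∀ t : ℝ, p + t • g ∈ K ↔ 0 ≤ t ∧ t ≤ chHi K g p := by
    intro g hg h
    have hd : p ∈ chDom K g := ⟨_, h⟩
    obtain ⟨k1, k2, k3⟩ := chord_spec hc hcl hb hg hd
    have b1 := (k3 _).1 h
    rw [hcl.frontier_eq] at hPf
    have b2 := (k2 0).1 (by simpa using hPf.1)
    have b3 : chLo K g p = 0 := by
      by_contra hne
      apply hPf.2
      have := (k3 0).2 ⟨lt_of_le_of_ne b2.1 hne, by linarith⟩
      simpa using this
    rw [b3] at k1 k2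
    exact ⟨hd, b3, k1, k2⟩
  obtain ⟨d1, l1, m1, n1⟩ := base e he hpe
  obtain ⟨d2, l2, m2, n2⟩ := base f hf hpf
  have c1 := hall3 p d1 hpx
  have c2 := hall2 p d2 hpx
  unfold chApex at c1 c2
  rw [l1] at c1
  rw [l2] at c2
  simp only [zero_smul, add_zero, sub_zero] at c1 c2
  rw [n2] at c1
  rw [n1] at c2
  push Not at c1 c2
  linarith [c1 m1.le, c2 m2.le]

end Core2
section Core3
open Set Filter Topology

variable {F : Type*} [NormedAddCommGroup F] [NormedSpace ℝ F]
variable {E : Type*} [NormedAddCommGroup E] [NormedSpace ℝ E]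

lemma inscr_chord {K : Set F} (hc : Convex ℝ K) (hcl : IsClosed K) (hb : Bornology.IsBounded K)
    {e f : F} (he : e ≠ 0) (We : StrictDir K e) {q : F × ℝ} (hq : q ∈ inscr K e f)
    {z : F} {t : ℝ} (hz : q.1 = z + t • e) :
    z ∈ chDom K e ∧ chLo K e z = t ∧ chHi K e z = t + q.2 ∧ chApex K e f z ∈ frontier K := by
  obtain ⟨h0, h1, h2, h3⟩ := hq
  have hi := We _ (hcl.frontier_subset h1) q.2 h0 (hcl.frontier_subset h2) (q.2 / 2)
    (half_pos h0) (by linarith)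
  have hd : z ∈ chDom K e := ⟨t + q.2 / 2, by convert hi using 1; rw [hz]; module⟩
  obtain ⟨h4, h5⟩ := chord_eq hc hcl hb he (a := t) (b := t + q.2) (by linarith) hd
    (by rw [← hz]; exact h1) (by convert h2 using 1; rw [hz]; module)
  refine ⟨hd, h4, h5, ?_⟩
  unfold chApex
  rw [h4, h5, ← hz]
  convert h3 using 2
  module

lemma inscr_openEmb {K : Set F} (hc : Convex ℝ K) (hcl : IsClosed K) (hb : Bornology.IsBounded K)
    {e f : F} (he : e ≠ 0)
    (We : StrictDir K e) (Wf : StrictDir K f) (Wfe : StrictDir K (f - e))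
    (π : F →ₗ[ℝ] E) (hπ : Continuous π) (σ : E →ₗ[ℝ] F) (hσ : Continuous σ)
    (πe : π e = 0) (πf : π f = 0) (πσ : ∀ x, π (σ x) = x)
    (dec : ∀ z, ∃ s t : ℝ, z = σ (π z) + s • f + t • e) :
    IsOpenEmbedding (fun q : inscr K e f => π q.1.1) := by
  apply IsOpenEmbedding.of_continuous_injective_isOpenMap
  · fun_prop
  · -- injectivity
    rintro ⟨q, hq⟩ ⟨q', hq'⟩ h
    simp only at h
    obtain ⟨s, t, hz⟩ := dec q.1
    obtain ⟨s', t', hz'⟩ := dec q'.1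
    rw [← h] at hz'
    obtain ⟨a1, a2, a3, a4⟩ := inscr_chord hc hcl hb he We hq hz
    obtain ⟨b1, b2, b3, b4⟩ := inscr_chord hc hcl hb he We hq' hz'
    have key : ∀ u v : ℝ, u < v → σ (π q.1) + u • f ∈ chDom K e →
        σ (π q.1) + v • f ∈ chDom K e → chApex K e f (σ (π q.1) + u • f) ∈ frontier K →
        chApex K e f (σ (π q.1) + v • f) ∈ frontier K → False := by
      intro u v huv hu hv fu fv
      have heq : σ (π q.1) + u • f + (v - u) • f + (0:ℝ) • e = σ (π q.1) + v • f := by module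
      have := mono hc hcl hb he We Wf Wfe (sub_pos.2 huv) hu (t := 0)
        (by rw [heq]; exact hv) (by rw [heq]; exact hcl.frontier_subset fv)
      rw [hcl.frontier_eq] at fu
      exact fu.2 this
    have hss : s = s' := by
      rcases lt_trichotomy s s' with h | h | h
      · exact (key _ _ h a1 b1 a4 b4).elim
      · exact h
      · exact (key _ _ h b1 a1 b4 a4).elim
    subst hss
    have htt : t = t' := by rw [← a2, ← b2]
    subst htt
    have hll : q.2 = q'.2 := by linarith
    exact Subtype.ext (Prod.ext (by rw [hz, hz']) hll)
  · -- open map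
    rw [isOpenMap_iff_nhds_le]
    rintro ⟨q, hq⟩
    intro G hG
    rw [mem_map, nhds_subtype, mem_comap] at hG
    obtain ⟨G', hG', hsub⟩ := hG
    obtain ⟨s0, t0, hz⟩ := dec q.1
    simp only
    set x0 := π q.1 with hx0
    obtain ⟨a1, a2, a3, a4⟩ := inscr_chord hc hcl hb he We hq hz
    -- the parametrisation
    have hm : ContinuousAt (fun z => (z + chLo K e z • e, chHi K e z - chLo K e z))
        (σ x0 + s0 • f) := by
      have h1 := chHi_cont hc hcl hb he a1
      have h2 := chLo_cont hc hcl hb he a1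
      fun_prop
    have hcz : Continuous (fun y : E × ℝ => σ y.1 + y.2 • f) := by fun_prop
    have hev1 : ∀ᶠ z in 𝓝 (σ x0 + s0 • f), z ∈ chDom K e ∧
        (z + chLo K e z • e, chHi K e z - chLo K e z) ∈ G' := by
      refine Filter.Eventually.and ((chDom_open K e).mem_nhds a1) ?_
      apply hm
      convert hG'
      simp only
      rw [a2, a3]
      exact Prod.ext hz.symm (by simp)
    have hev : ∀ᶠ y : E × ℝ in 𝓝 (x0, s0), σ y.1 + y.2 • f ∈ chDom K e ∧
        (σ y.1 + y.2 • f + chLo K e (σ y.1 + y.2 • f) • e,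
          chHi K e (σ y.1 + y.2 • f) - chLo K e (σ y.1 + y.2 • f)) ∈ G' :=
      hcz.continuousAt (x := (x0, s0)) hev1
    obtain ⟨δ, hδ, hball⟩ := Metric.eventually_nhds_iff.1 hev
    have hgood : ∀ x s, dist x x0 < δ → |s - s0| < δ → σ x + s • f ∈ chDom K e ∧
        (σ x + s • f + chLo K e (σ x + s • f) • e,
          chHi K e (σ x + s • f) - chLo K e (σ x + s • f)) ∈ G' := by
      intro x s hx hs
      exact hball (y := (x, s)) (by rw [Prod.dist_eq]; exact max_lt hx hs)
    have hδ2 : |δ / 2| < δ := by rw [abs_of_pos] <;> linarith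
    have dm := (hgood x0 (s0 - δ / 2) (by simpa using hδ) (by
      rw [sub_sub_cancel_left, abs_neg]; exact hδ2)).1
    have dp := (hgood x0 (s0 + δ / 2) (by simpa using hδ) (by
      rw [add_sub_cancel_left]; exact hδ2)).1
    have apm : chApex K e f (σ x0 + (s0 - δ / 2) • f) ∈ interior K := by
      have heq : σ x0 + (s0 - δ / 2) • f + (δ / 2) • f + (0:ℝ) • e = σ x0 + s0 • f := by module
      exact mono hc hcl hb he We Wf Wfe (half_pos hδ) dm (t := 0)
        (by rw [heq]; exact a1) (by rw [heq]; exact hcl.frontier_subset a4)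
    have app : chApex K e f (σ x0 + (s0 + δ / 2) • f) ∉ K := by
      intro hK
      have heq : σ x0 + s0 • f + (δ / 2) • f + (0:ℝ) • e = σ x0 + (s0 + δ / 2) • f := by module
      have := mono hc hcl hb he We Wf Wfe (half_pos hδ) a1 (t := 0)
        (by rw [heq]; exact dp) (by rw [heq]; exact hK)
      rw [hcl.frontier_eq] at a4
      exact a4.2 this
    have hcx : ∀ s : ℝ, ContinuousAt (fun x : E => σ x + s • f) x0 := fun s => by fun_prop
    have evm : ∀ᶠ x in 𝓝 x0, chApex K e f (σ x + (s0 - δ / 2) • f) ∈ interior K :=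
      (ContinuousAt.comp (f := fun x : E => σ x + (s0 - δ / 2) • f)
        (chApex_cont hc hcl hb he f dm) (hcx _)) (isOpen_interior.mem_nhds apm)
    have evp : ∀ᶠ x in 𝓝 x0, chApex K e f (σ x + (s0 + δ / 2) • f) ∈ Kᶜ :=
      (ContinuousAt.comp (f := fun x : E => σ x + (s0 + δ / 2) • f)
        (chApex_cont hc hcl hb he f dp) (hcx _)) (hcl.isOpen_compl.mem_nhds app)
    filter_upwards [evm, evp, Metric.ball_mem_nhds x0 hδ] with x xm xp xb
    have dmx := (hgood x (s0 - δ / 2) xb (by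
      rw [sub_sub_cancel_left, abs_neg]; exact hδ2)).1
    have dpx := (hgood x (s0 + δ / 2) xb (by
      rw [add_sub_cancel_left]; exact hδ2)).1
    obtain ⟨y, ⟨a, b, ha, hb', hab, hy⟩, hyd, hyf⟩ :=
      ivt hc hcl hb he dpx dmx xp (interior_subset xm)
    have hy' : y = σ x + (s0 + (a - b) * (δ / 2)) • f := by
      have hb1 : b = 1 - a := by linarith
      rw [← hy, hb1]; module
    have hg := (hgood x (s0 + (a - b) * (δ / 2)) xb (by
      rw [add_sub_cancel_left, abs_mul, abs_of_pos (half_pos hδ)]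
      have : |a - b| ≤ 1 := by rw [abs_le]; constructor <;> linarith
      nlinarith)).2
    rw [← hy'] at hg
    have hins := inscr_of_apex hc hcl hb he hyd hyf
    have : (⟨_, hins⟩ : inscr K e f) ∈ (fun q : inscr K e f => π q.1.1) ⁻¹' G := hsub hg
    rw [mem_preimage] at this
    convert this using 1
    simp [hy', πe, πf, πσ]

lemma inscr_nonempty {K : Set F} (hc : Convex ℝ K) (hcl : IsClosed K) (hb : Bornology.IsBounded K)
    {e f : F} (he : e ≠ 0) (hf : f ≠ 0)
    (We : StrictDir K e) (Wf : StrictDir K f) (Wfe : StrictDir K (f - e))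
    (Wef : StrictDir K (e - f))
    (π : F →ₗ[ℝ] E) (hπ : Continuous π) (σ : E →ₗ[ℝ] F) (hσ : Continuous σ)
    (πe : π e = 0) (πf : π f = 0) (πσ : ∀ x, π (σ x) = x)
    (h1 : (nSet K e f).Nonempty) (h2 : (nSet K (-e) (f - e)).Nonempty)
    (h3 : (nSet K (-f) (e - f)).Nonempty) : (inscr K e f).Nonempty := by
  have hopen : IsOpenMap π := by
    rw [isOpenMap_iff_nhds_le]
    intro z G hG
    rw [mem_map] at hG
    have hct : ContinuousAt (fun x => z + σ (x - π z)) (π z) := by fun_prop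
    have : ∀ᶠ x in 𝓝 (π z), z + σ (x - π z) ∈ π ⁻¹' G := hct (by simpa using hG)
    filter_upwards [this] with x hx
    simpa [πσ] using hx
  set O1 := π '' nSet K e f with hO1
  set O2 := π '' nSet K (-e) (f - e) with hO2
  set O3 := π '' nSet K (-f) (e - f) with hO3
  have o1 : IsOpen O1 := hopen _ (nSet_open hcl _ _)
  have o2 : IsOpen O2 := hopen _ (nSet_open hcl _ _)
  have o3 : IsOpen O3 := hopen _ (nSet_open hcl _ _)
  set B := π '' interior K with hB
  have hpre : IsPreconnected B := hc.interior.isPreconnected.image _ hπ.continuousOn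
  have hsame : ∀ z w : F, samePlane e f z w → π w = π z := by
    rintro z w ⟨s, t, rfl⟩; simp [πe, πf]
  have hsame' : ∀ z w : F, samePlane f e z w → π w = π z := by
    rintro z w ⟨s, t, rfl⟩; simp [πe, πf]
  have A : ∀ x ∈ B, x ∈ O3 ∨ (x ∈ O1 ∧ x ∈ O2) := by
    rintro _ ⟨z, hz, rfl⟩
    rcases two_of_three hc hcl hb he Wf Wfe hz with ⟨w, hw, hp⟩ | ⟨⟨w, hw, hp⟩, w', hw', hp'⟩
    · exact Or.inl ⟨w, hw, hsame _ _ hp⟩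
    · exact Or.inr ⟨⟨w, hw, hsame _ _ hp⟩, ⟨w', hw', hsame _ _ hp'⟩⟩
  have A' : ∀ x ∈ B, x ∈ O2 ∨ (x ∈ O1 ∧ x ∈ O3) := by
    rintro _ ⟨z, hz, rfl⟩
    rcases two_of_three hc hcl hb hf We Wef hz with ⟨w, hw, hp⟩ | ⟨⟨w, hw, hp⟩, w', hw', hp'⟩
    · exact Or.inl ⟨w, hw, hsame' _ _ hp⟩
    · exact Or.inr ⟨⟨w, nSet_comm K f e ▸ hw, hsame' _ _ hp⟩, ⟨w', hw', hsame' _ _ hp'⟩⟩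
  have n1 : (B ∩ O1).Nonempty := by
    obtain ⟨z, hz⟩ := h1
    obtain ⟨-, l, -, hl, -⟩ := id hz
    exact ⟨π z, ⟨_, hl, by simp [πe]⟩, ⟨z, hz, rfl⟩⟩
  have n2 : (B ∩ O2).Nonempty := by
    obtain ⟨z, hz⟩ := h2
    obtain ⟨-, l, -, hl, -⟩ := id hz
    exact ⟨π z, ⟨_, hl, by simp [πe]⟩, ⟨z, hz, rfl⟩⟩
  have n3 : (B ∩ O3).Nonempty := by
    obtain ⟨z, hz⟩ := h3
    obtain ⟨-, l, -, hl, -⟩ := id hz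
    exact ⟨π z, ⟨_, hl, by simp [πf]⟩, ⟨z, hz, rfl⟩⟩
  have s1 := hpre O2 O3 o2 o3 (fun x hx => by
    rcases A x hx with h | h
    · exact Or.inr h
    · exact Or.inl h.2) n2 n3
  obtain ⟨x, -, hx1, hx2, hx3⟩ := hpre O1 (O2 ∩ O3) o1 (o2.inter o3) (fun x hx => by
    rcases A x hx with h | h
    · rcases A' x hx with h' | h'
      · exact Or.inr ⟨h', h⟩
      · exact Or.inl h'.1
    · exact Or.inl h.1) n1 s1
  obtain ⟨q, hq, -⟩ := exists_inscr hc hcl hb he hf π πe πf hx1 hx2 hx3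
  exact ⟨q, hq⟩

end Core3
section Final
open Set Filter Topology

lemma strict_of_wgp {d : ℕ} {K : Set (Fin d → ℝ)} (hc : Convex ℝ K) (hcl : IsClosed K)
    {v : Fin d → ℝ} (hv : v ≠ 0) (h : WeakGenPos K v) : StrictDir K v := by
  intro z hz t ht hzt τ hτ hτt
  by_contra hni
  apply h
  refine ⟨z, z + t • v, ?_, ?_, t, by simp⟩
  · intro heq
    have : t • v = 0 := by simpa using heq
    rcases smul_eq_zero.1 this with h | h
    · exact ht.ne' h
    · exact hv h
  · have hz0 : z + (0:ℝ) • v ∈ K := by simpa using hz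
    rintro _ ⟨a, b, ha, hb, hab, rfl⟩
    have heq : a • z + b • (z + t • v) = z + (b * t) • v := by
      have : a = 1 - b := by linarith
      rw [this]; module
    rw [heq, hcl.frontier_eq]
    refine ⟨line_mem hc hz0 hzt (by positivity) (by nlinarith), fun hi => hni ?_⟩
    rcases le_total (b * t) τ with h | h
    · exact line_int hc hi hzt (Or.inl ⟨h, hτt⟩)
    · exact line_int hc hi hz0 (Or.inr ⟨hτ, h⟩)

lemma halfsphere_int {d : ℕ} {K : Set (Fin d → ℝ)} (hc : Convex ℝ K) (hcl : IsClosed K)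
    (h0 : (interior K).Nonempty) {v z : Fin d → ℝ} (h : z ∈ Halfsphere K v) :
    ∃ t : ℝ, 0 < t ∧ z + t • (-v) ∈ interior K := by
  obtain ⟨hzf, hl⟩ := h
  have hz := hzf
  rw [hcl.frontier_eq] at hz
  by_contra hcon
  push Not at hcon
  set T : Set (Fin d → ℝ) := (fun t : ℝ => z + t • (-v)) '' Ici 0 with hT
  have hTc : Convex ℝ T := by
    rintro _ ⟨s, hs, rfl⟩ _ ⟨t, ht, rfl⟩ a b ha hb hab
    refine ⟨a * s + b * t, ?_, ?_⟩
    · have hs' : (0:ℝ) ≤ s := hs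
      have ht' : (0:ℝ) ≤ t := ht
      show (0:ℝ) ≤ _
      positivity
    · have : a = 1 - b := by linarith
      simp only [this]; module
  have hdisj : Disjoint (interior K) T := by
    rw [Set.disjoint_right]
    rintro _ ⟨t, ht, rfl⟩
    rcases eq_or_lt_of_le (show (0:ℝ) ≤ t from ht) with h | h
    · subst h; simpa using hz.2
    · exact hcon t h
  obtain ⟨l, u, hl1, hl2⟩ := geometric_hahn_banach_open hc.interior isOpen_interior hTc hdisj
  have hzu : u ≤ l z := by simpa using hl2 _ ⟨0, by simp, rfl⟩
  have hKu : ∀ y ∈ K, l y ≤ u := by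
    intro y hy
    have hy' : y ∈ closure (interior K) := by
      rw [hc.closure_interior_eq_closure_of_nonempty_interior h0]; exact subset_closure hy
    exact closure_minimal (fun w hw => (hl1 w hw).le) (isClosed_le l.continuous continuous_const) hy'
  have hlne : l ≠ 0 := by
    rintro rfl
    obtain ⟨w, hw⟩ := h0
    have := hl1 w hw
    simp at this hzu
    linarith
  have hpos := hl l hlne (fun y hy => (hKu y hy).trans hzu)
  have h1 := hl2 _ ⟨1, by simp, rfl⟩
  have h2 := hKu z hz.1
  simp at h1
  linarith

lemma opp_false {F : Type*} [NormedAddCommGroup F] [NormedSpace ℝ F] {K : Set F}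
    (hc : Convex ℝ K) (hcl : IsClosed K) {z g : F} (hz : z ∈ frontier K) {s t : ℝ} (hs : s ≤ 0)
    (ht : 0 < t) (h1 : z + s • g ∈ interior K) (h2 : z + t • g ∈ interior K) : False := by
  rw [hcl.frontier_eq] at hz
  apply hz.2
  have := line_int hc h1 (interior_subset h2) (Or.inl ⟨hs, ht⟩)
  simpa using this

lemma exists_split {d : ℕ} {e f : Fin d → ℝ} (hli : LinearIndependent ℝ ![e, f]) :
    ∃ (π : (Fin d → ℝ) →ₗ[ℝ] (Fin (d - 2) → ℝ)) (σ : (Fin (d - 2) → ℝ) →ₗ[ℝ] (Fin d → ℝ)),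
      π e = 0 ∧ π f = 0 ∧ (∀ x, π (σ x) = x) ∧
      ∀ z, ∃ s t : ℝ, z = σ (π z) + s • f + t • e := by
  set V : Submodule ℝ (Fin d → ℝ) := Submodule.span ℝ (range ![e, f]) with hV
  have hVr : V = Submodule.span ℝ {e, f} := by rw [hV]; simp [Set.pair_comm]
  obtain ⟨W, hW⟩ := Submodule.exists_isCompl V
  have hfr : Module.finrank ℝ V = 2 := by
    rw [hV, finrank_span_eq_card hli]; simp
  have hfW : Module.finrank ℝ W = d - 2 := by
    have := Submodule.finrank_add_eq_of_isCompl hW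
    rw [hfr] at this
    simp at this
    omega
  let φ : (Fin (d - 2) → ℝ) ≃ₗ[ℝ] W := LinearEquiv.ofFinrankEq _ _ (by simp [hfW])
  have heV : e ∈ V := Submodule.subset_span ⟨0, rfl⟩
  have hfV : f ∈ V := Submodule.subset_span ⟨1, rfl⟩
  refine ⟨φ.symm.toLinearMap ∘ₗ W.projectionOnto V hW.symm, W.subtype ∘ₗ φ.toLinearMap,
    ?_, ?_, ?_, ?_⟩
  · simpa using heV
  · simpa using hfV
  · intro x; simp
  · intro z
    have hz : z - (W.projectionOnto V hW.symm z : Fin d → ℝ) ∈ V := by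
      rw [← Submodule.projectionOnto_apply_eq_zero_iff hW.symm, map_sub, sub_eq_zero]
      exact (Submodule.projectionOnto_apply_left hW.symm _).symm
    have hz2 := hVr.le hz
    rw [Submodule.mem_span_pair] at hz2
    obtain ⟨a, b, hab⟩ := hz2
    refine ⟨b, a, ?_⟩
    have hs : (W.subtype ∘ₗ φ.toLinearMap)
        ((φ.symm.toLinearMap ∘ₗ W.projectionOnto V hW.symm) z) =
        (W.projectionOnto V hW.symm z : Fin d → ℝ) := by simp
    rw [hs, add_assoc, add_comm (b • f), hab]
    abel

lemma bis_homeo {F : Type*} [NormedAddCommGroup F] [NormedSpace ℝ F] {K : Set F}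
    (hc : Convex ℝ K) (hb : Bornology.IsBounded K)
    (h0 : K ∈ 𝓝 (0 : F)) (a₁ a₂ a₃ : F) (h12 : a₁ ≠ a₂) :
    Nonempty ({x : F | gauge K (x - a₁) = gauge K (x - a₂) ∧
        gauge K (x - a₂) = gauge K (x - a₃)} ≃ₜ inscr K (a₁ - a₂) (a₁ - a₃)) := by
  have hgc : Continuous (gauge K) := continuous_gauge hc h0
  have hpos : ∀ x : F, 0 < gauge K x ↔ x ≠ 0 := fun x =>
    gauge_pos (absorbent_nhds_zero h0) (NormedSpace.isVonNBounded_of_isBounded ℝ hb)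
  have hfr : ∀ x : F, x ∈ frontier K ↔ gauge K x = 1 := fun x =>
    (gauge_eq_one_iff_mem_frontier hc h0).symm
  have hsm : ∀ (c : ℝ) (x : F), 0 < c → gauge K (c • x) = c * gauge K x := fun c x hc =>
    gauge_smul_of_nonneg hc.le x
  set S : Set F := {x : F | gauge K (x - a₁) = gauge K (x - a₂) ∧
        gauge K (x - a₂) = gauge K (x - a₃)} with hS
  have hr : ∀ x ∈ S, 0 < gauge K (x - a₁) := by
    intro x hx
    by_contra hneg
    have e1 : x - a₁ = 0 := by
      by_contra h; exact hneg ((hpos _).2 h)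
    have e2 : x - a₂ = 0 := by
      by_contra h; apply hneg; rw [hx.1]; exact (hpos _).2 h
    exact h12 ((sub_eq_zero.1 e1).symm.trans (sub_eq_zero.1 e2))
  have hto : ∀ x ∈ S, ((gauge K (x - a₁))⁻¹ • (x - a₁), (gauge K (x - a₁))⁻¹) ∈
      inscr K (a₁ - a₂) (a₁ - a₃) := by
    intro x hx
    have h := hr x hx
    have hi : 0 < (gauge K (x - a₁))⁻¹ := inv_pos.2 h
    refine ⟨hi, ?_, ?_, ?_⟩
    · rw [hfr, hsm _ _ hi, inv_mul_cancel₀ h.ne']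
    · simp only
      rw [← smul_add, sub_add_sub_cancel, hfr, hsm _ _ hi, ← hx.1, inv_mul_cancel₀ h.ne']
    · simp only
      rw [← smul_add, sub_add_sub_cancel, hfr, hsm _ _ hi, ← hx.2, ← hx.1, inv_mul_cancel₀ h.ne']
  have hg : ∀ q ∈ inscr K (a₁ - a₂) (a₁ - a₃), gauge K (q.2⁻¹ • q.1 + a₁ - a₁) = q.2⁻¹ ∧
      gauge K (q.2⁻¹ • q.1 + a₁ - a₂) = q.2⁻¹ ∧ gauge K (q.2⁻¹ • q.1 + a₁ - a₃) = q.2⁻¹ := by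
    rintro ⟨p, l⟩ ⟨hl, h1, h2, h3⟩
    simp only at hl h1 h2 h3 ⊢
    have hi : 0 < l⁻¹ := inv_pos.2 hl
    have key : ∀ a : F, l⁻¹ • p + a₁ - a = l⁻¹ • (p + l • (a₁ - a)) := by
      intro a
      rw [smul_add, smul_smul, inv_mul_cancel₀ hl.ne', one_smul, add_sub_assoc]
    rw [hfr] at h1 h2 h3
    refine ⟨?_, ?_, ?_⟩
    · rw [key, hsm _ _ hi]; simp [h1]
    · rw [key, hsm _ _ hi, h2, mul_one]
    · rw [key, hsm _ _ hi, h3, mul_one]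
  refine ⟨{
    toFun := fun x => ⟨_, hto x.1 x.2⟩
    invFun := fun q => ⟨q.1.2⁻¹ • q.1.1 + a₁, by
      obtain ⟨h1, h2, h3⟩ := hg q.1 q.2
      exact ⟨h1.trans h2.symm, h2.trans h3.symm⟩⟩
    left_inv := ?_
    right_inv := ?_
    continuous_toFun := ?_
    continuous_invFun := ?_ }⟩
  · rintro ⟨x, hx⟩
    apply Subtype.ext
    have h := (hr x hx).ne'
    simp only [inv_inv, smul_smul]
    rw [mul_inv_cancel₀ h, one_smul, sub_add_cancel]
  · rintro ⟨q, hq⟩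
    apply Subtype.ext
    have h1 := (hg q hq).1
    have hq0 := hq.1.ne'
    simp only
    rw [h1]
    ext1
    · simp [smul_smul, hq0]
    · simp
  · apply Continuous.subtype_mk
    have hc1 : Continuous (fun x : S => gauge K (x.1 - a₁)) := by fun_prop
    have hc2 : Continuous (fun x : S => (gauge K (x.1 - a₁))⁻¹) :=
      hc1.inv₀ (fun x => (hr x.1 x.2).ne')
    exact (hc2.smul (by fun_prop)).prodMk hc2
  · apply Continuous.subtype_mk
    have hc1 : Continuous (fun q : inscr K (a₁ - a₂) (a₁ - a₃) => (q.1.2)⁻¹) :=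
      Continuous.inv₀ (by fun_prop) (fun q => q.2.1.ne')
    exact (hc1.smul (by fun_prop)).add continuous_const

end Final

theorem three_point_bisector_homeo_open {d : ℕ} (K : Set (Fin d → ℝ))
    (hK : ∃ s : Finset (Fin d → ℝ), K = convexHull ℝ (s : Set (Fin d → ℝ)))
    (h0 : 0 ∈ interior K) (a₁ a₂ a₃ : Fin d → ℝ)
    (h12 : a₁ ≠ a₂) (h13 : a₁ ≠ a₃) (h23 : a₂ ≠ a₃)
    (hwgp : ∀ p ∈ ({a₁, a₂, a₃} : Set (Fin d → ℝ)),
      ∀ q ∈ ({a₁, a₂, a₃} : Set (Fin d → ℝ)), p ≠ q → WeakGenPos K (q - p))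
    (hsec : ∀ p ∈ ({a₁, a₂, a₃} : Set (Fin d → ℝ)),
      (⋂ q ∈ ({a₁, a₂, a₃} : Set (Fin d → ℝ)) \ {p},
        Halfsphere K (q - p)).Nonempty) :
    ∃ U : Set (Fin (d - 2) → ℝ), IsOpen U ∧ U.Nonempty ∧
      Nonempty ({x : Fin d → ℝ | gauge K (x - a₁) = gauge K (x - a₂) ∧
        gauge K (x - a₂) = gauge K (x - a₃)} ≃ₜ U) := by
  obtain ⟨s, hs⟩ := hK
  have hc : Convex ℝ K := by rw [hs]; exact convex_convexHull ℝ _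
  have hcomp : IsCompact K := by rw [hs]; exact s.finite_toSet.isCompact_convexHull ℝ
  have hcl : IsClosed K := hcomp.isClosed
  have hb : Bornology.IsBounded K := hcomp.isBounded
  have hne : (interior K).Nonempty := ⟨0, h0⟩
  have m1 : a₁ ∈ ({a₁, a₂, a₃} : Set (Fin d → ℝ)) := by simp
  have m2 : a₂ ∈ ({a₁, a₂, a₃} : Set (Fin d → ℝ)) := by simp
  have m3 : a₃ ∈ ({a₁, a₂, a₃} : Set (Fin d → ℝ)) := by simp
  have We : StrictDir K (a₁ - a₂) :=
    strict_of_wgp hc hcl (sub_ne_zero.2 h12) (hwgp _ m2 _ m1 h12.symm)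
  have Wf : StrictDir K (a₁ - a₃) :=
    strict_of_wgp hc hcl (sub_ne_zero.2 h13) (hwgp _ m3 _ m1 h13.symm)
  have Wfe : StrictDir K ((a₁ - a₃) - (a₁ - a₂)) := by
    rw [sub_sub_sub_cancel_left]
    exact strict_of_wgp hc hcl (sub_ne_zero.2 h23) (hwgp _ m3 _ m2 h23.symm)
  have Wef : StrictDir K ((a₁ - a₂) - (a₁ - a₃)) := by
    rw [sub_sub_sub_cancel_left]
    exact strict_of_wgp hc hcl (sub_ne_zero.2 h23.symm) (hwgp _ m2 _ m3 h23)
  -- the sector points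
  have sec : ∀ p ∈ ({a₁, a₂, a₃} : Set (Fin d → ℝ)), ∃ z ∈ frontier K,
      ∀ q ∈ ({a₁, a₂, a₃} : Set (Fin d → ℝ)), q ≠ p →
      ∃ t : ℝ, 0 < t ∧ z + t • (p - q) ∈ interior K := by
    intro p hp
    obtain ⟨z, hz⟩ := hsec p hp
    simp only [Set.mem_iInter] at hz
    have hint : ∀ q ∈ ({a₁, a₂, a₃} : Set (Fin d → ℝ)), q ≠ p → z ∈ Halfsphere K (q - p) :=
      fun q hq hqp => hz q ⟨hq, hqp⟩
    have hzf : z ∈ frontier K := by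
      by_cases h : a₁ = p
      · exact (hint a₂ m2 (by rw [← h]; exact h12.symm)).1
      · exact (hint a₁ m1 h).1
    refine ⟨z, hzf, fun q hq hqp => ?_⟩
    obtain ⟨t, ht, h⟩ := halfsphere_int hc hcl hne (hint q hq hqp)
    exact ⟨t, ht, by rwa [neg_sub] at h⟩
  obtain ⟨z1, f1, s1⟩ := sec a₁ m1
  obtain ⟨z2, f2, s2⟩ := sec a₂ m2
  obtain ⟨z3, f3, s3⟩ := sec a₃ m3
  obtain ⟨t12, p12, i12⟩ := s1 a₂ m2 h12.symm
  obtain ⟨t13, p13, i13⟩ := s1 a₃ m3 h13.symm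
  obtain ⟨t21, p21, i21⟩ := s2 a₁ m1 h12
  obtain ⟨t23, p23, i23⟩ := s2 a₃ m3 h23.symm
  obtain ⟨t31, p31, i31⟩ := s3 a₁ m1 h13
  obtain ⟨t32, p32, i32⟩ := s3 a₂ m2 h23
  have he : a₁ - a₂ ≠ 0 := sub_ne_zero.2 h12
  have hf : a₁ - a₃ ≠ 0 := sub_ne_zero.2 h13
  have hfe : (a₁ - a₃) - (a₁ - a₂) ≠ 0 := by
    rw [sub_sub_sub_cancel_left]; exact sub_ne_zero.2 h23
  have r21 : a₂ - a₁ = -(a₁ - a₂) := by abel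
  have r31 : a₃ - a₁ = -(a₁ - a₃) := by abel
  have r23 : a₂ - a₃ = (a₁ - a₃) - (a₁ - a₂) := by abel
  have r32 : a₃ - a₂ = (a₁ - a₂) - (a₁ - a₃) := by abel
  rw [r21] at i21
  rw [r31] at i31
  rw [r23] at i23
  rw [r32] at i32
  have hhomeo := bis_homeo hc hb (mem_interior_iff_mem_nhds.1 h0) a₁ a₂ a₃ h12
  generalize a₁ - a₂ = e at *
  generalize a₁ - a₃ = f at *
  have hli : LinearIndependent ℝ ![e, f] := by
    rw [LinearIndependent.pair_iff' he]
    intro a haf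
    subst haf
    have ha0 : a ≠ 0 := by rintro rfl; simp at hf
    have ha1 : a ≠ 1 := by rintro rfl; simp at hfe
    rcases lt_or_gt_of_ne ha0 with h | h
    · exact opp_false hc hcl f1 (g := e) (s := t13 * a) (t := t12) (by nlinarith) p12
        (by convert i13 using 1; module) i12
    · rcases lt_or_gt_of_ne ha1 with h' | h'
      · exact opp_false hc hcl f3 (g := e) (s := - (t31 * a)) (t := t32 * (1 - a)) (by nlinarith)
          (by nlinarith) (by convert i31 using 1; module) (by convert i32 using 1; module)
      · exact opp_false hc hcl f2 (g := e) (s := - t21) (t := t23 * (a - 1)) (by linarith)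
          (by nlinarith) (by convert i21 using 1; module) (by convert i23 using 1; module)
  obtain ⟨π, σ, πe, πf, πσ, dec⟩ := exists_split hli
  have hπ : Continuous π := π.continuous_of_finiteDimensional
  have hσ : Continuous σ := σ.continuous_of_finiteDimensional
  have hemb := inscr_openEmb hc hcl hb he We Wf Wfe π hπ σ hσ πe πf πσ dec
  obtain ⟨_, n1⟩ := nSet_of_frontier hc hcl f1 p12 p13 i12 i13
  obtain ⟨_, n2⟩ := nSet_of_frontier hc hcl f2 p21 p23 i21 i23
  obtain ⟨_, n3⟩ := nSet_of_frontier hc hcl f3 p31 p32 i31 i32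
  obtain ⟨q, hq⟩ := inscr_nonempty hc hcl hb he hf We Wf Wfe Wef π hπ σ hσ πe πf πσ
    ⟨_, n1⟩ ⟨_, n2⟩ ⟨_, n3⟩
  obtain ⟨Φ⟩ := hhomeo
  exact ⟨_, hemb.isOpen_range, ⟨_, ⟨⟨q, hq⟩, rfl⟩⟩, ⟨Φ.trans hemb.isEmbedding.toHomeomorph⟩⟩
end
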